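/- Let f, g_1, …, g_m ∈ ℝ[x] with g = (g_1,…,g_m). Assume that f is non-negative on S(g) and that the image f(C(g)) := {f(x) : x ∈ C(g)} is a finite set. Then there exists q ∈ P(g)[x, λ̄] such that f − q vanishes identically on V(h_FJ) ⊂ ℝ^{n+m+1}. -/

import Mathlib

open MvPolynomial

noncomputable section

/-- `p` is a sum of squares of polynomials. -/
def IsSOS {σ : Type*} (p : MvPolynomial σ ℝ) : Prop :=
  ∃ (k : ℕ) (q : Fin k → MvPolynomial σ ℝ), p = ∑ i, q i ^ 2

/-- Membership in the preordering `P(g)` generated by the tuple `g`. -/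
def InPre {σ ι : Type*} [Fintype ι] [DecidableEq ι] (g : ι → MvPolynomial σ ℝ)
    (p : MvPolynomial σ ℝ) : Prop :=
  ∃ s : Finset ι → MvPolynomial σ ℝ, (∀ A, IsSOS (s A)) ∧
    p = ∑ A : Finset ι, s A * ∏ j ∈ A, g j

/-- The basic semi-algebraic set `S(g)`. -/
def Sg {n m : ℕ} (g : Fin m → MvPolynomial (Fin n) ℝ) : Set (Fin n → ℝ) :=
  {x | ∀ j, 0 ≤ eval x (g j)}

/-- The set of critical points `C(g)`. -/
def Cset {n m : ℕ} (g : Fin m → MvPolynomial (Fin n) ℝ) : Set (Fin n → ℝ) :=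
  {x | ∃ lam : Fin m → ℝ, lam ≠ 0 ∧
    (∀ i, ∑ j, lam j * eval x (pderiv i (g j)) = 0) ∧
    (∀ j, lam j * eval x (g j) = 0)}

/-- The real variety `V(h_FJ)` of the Fritz John system attached to `f` and `g`,
a subset of `ℝⁿ × ℝ^{m+1}`. -/
def VFJ {n m : ℕ} (f : MvPolynomial (Fin n) ℝ) (g : Fin m → MvPolynomial (Fin n) ℝ) :
    Set ((Fin n → ℝ) × (Fin (m + 1) → ℝ)) :=
  {p | (∀ i, p.2 0 * eval p.1 (pderiv i f) = ∑ j, p.2 j.succ * eval p.1 (pderiv i (g j)))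
    ∧ (∀ j, p.2 j.succ * eval p.1 (g j) = 0)
    ∧ (∑ j, p.2 j ^ 2 = 1)}

/-- The intermediate value property for polynomials over an ordered field. -/
def PolyIVT (R : Type*) [Field R] [LinearOrder R] : Prop :=
  ∀ (p : Polynomial R) (a b : R), a < b → p.eval a * p.eval b < 0 →
    ∃ c, a < c ∧ c < b ∧ p.eval c = 0

section Univariate

variable {R : Type*} [Field R] [LinearOrder R] [IsStrictOrderedRing R]

lemma PolyIVT.eval_mul_eval_pos (hR : PolyIVT R) {p : Polynomial R} {a b : R} (hab : a ≤ b)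
    (h : ∀ c, a ≤ c → c ≤ b → p.eval c ≠ 0) : 0 < p.eval a * p.eval b := by
  rcases hab.eq_or_lt with rfl | hab
  · exact mul_self_pos.2 (h a le_rfl le_rfl)
  · by_contra hn
    have hne : p.eval a * p.eval b ≠ 0 := mul_ne_zero (h a le_rfl hab.le) (h b hab.le le_rfl)
    obtain ⟨c, h1, h2, h3⟩ := hR p a b hab (lt_of_le_of_ne (not_lt.1 hn) hne)
    exact h c h1.le h2.le h3

lemma PolyIVT.rolle_adjacent (hR : PolyIVT R) {p : Polynomial R} (hp : p ≠ 0) {a b : R}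
    (hab : a < b) (ha : p.eval a = 0) (hb : p.eval b = 0)
    (hne : ∀ c, a < c → c < b → p.eval c ≠ 0) :
    ∃ c, a < c ∧ c < b ∧ p.derivative.eval c = 0 := by
  obtain ⟨q, hq, hqa⟩ := Polynomial.exists_eq_pow_rootMultiplicity_mul_and_not_dvd p hp a
  have hm : p.rootMultiplicity a ≠ 0 := by
    rw [← Nat.pos_iff_ne_zero, Polynomial.rootMultiplicity_pos hp]; exact ha
  obtain ⟨m, hm⟩ := Nat.exists_eq_succ_of_ne_zero hm
  rw [hm] at hq
  have hq0 : q ≠ 0 := by rintro rfl; simp at hqa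
  have hqb : q.eval b = 0 := by
    have := hb
    rw [hq] at this
    simpa [sub_eq_zero, hab.ne'] using this
  obtain ⟨g, hg, hgb⟩ := Polynomial.exists_eq_pow_rootMultiplicity_mul_and_not_dvd q hq0 b
  have hn : q.rootMultiplicity b ≠ 0 := by
    rw [← Nat.pos_iff_ne_zero, Polynomial.rootMultiplicity_pos hq0]; exact hqb
  obtain ⟨n, hn⟩ := Nat.exists_eq_succ_of_ne_zero hn
  rw [hn] at hg
  rw [Polynomial.dvd_iff_isRoot] at hqa hgb
  have hga : g.eval a ≠ 0 := by
    intro h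
    apply hqa
    rw [hg]; simp [h]
  have hgb : g.eval b ≠ 0 := hgb
  have hpg : ∀ c, p.eval c = (c - a) ^ (m + 1) * ((c - b) ^ (n + 1) * g.eval c) := by
    intro c; rw [hq, hg]; simp
  have hpos : 0 < g.eval a * g.eval b := by
    apply hR.eval_mul_eval_pos hab.le
    intro c hac hcb h
    rcases hac.eq_or_lt with rfl | hac
    · exact hga h
    rcases hcb.eq_or_lt with rfl | hcb
    · exact hgb h
    exact hne c hac hcb (by rw [hpg, h]; simp)
  set H : Polynomial R := Polynomial.C ((m : R) + 1) * (Polynomial.X - Polynomial.C b) * g +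
    Polynomial.C ((n : R) + 1) * (Polynomial.X - Polynomial.C a) * g +
    (Polynomial.X - Polynomial.C a) * (Polynomial.X - Polynomial.C b) * g.derivative with hH
  have hd : p.derivative = (Polynomial.X - Polynomial.C a) ^ m *
      (Polynomial.X - Polynomial.C b) ^ n * H := by
    rw [hq, hg, hH]
    simp only [Polynomial.derivative_mul, Polynomial.derivative_X_sub_C_pow, Nat.succ_eq_add_one,
      Nat.add_sub_cancel, map_add, map_one, Polynomial.C_eq_natCast, Nat.cast_add, Nat.cast_one]
    ring
  have hHa : H.eval a = (m + 1) * (a - b) * g.eval a := by simp [hH]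
  have hHb : H.eval b = (n + 1) * (b - a) * g.eval b := by simp [hH]
  obtain ⟨c, h1, h2, h3⟩ := hR H a b hab (by
    rw [hHa, hHb]
    have h1 : (0 : R) < m + 1 := by positivity
    have h2 : (0 : R) < n + 1 := by positivity
    have h3 : 0 < b - a := sub_pos.2 hab
    have := mul_pos (mul_pos (mul_pos h1 h2) (mul_pos h3 h3)) hpos
    linarith)
  exact ⟨c, h1, h2, by rw [hd, Polynomial.eval_mul, h3, mul_zero]⟩

lemma PolyIVT.rolle (hR : PolyIVT R) {p : Polynomial R} {a b : R}
    (hab : a < b) (ha : p.eval a = 0) (hb : p.eval b = 0) :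
    ∃ c, a < c ∧ c < b ∧ p.derivative.eval c = 0 := by
  by_cases hp : p = 0
  · obtain ⟨c, h1, h2⟩ := exists_between hab
    exact ⟨c, h1, h2, by simp [hp]⟩
  have hs : ((p.roots.toFinset).filter (fun c => a < c)).Nonempty :=
    ⟨b, by simp [hp, hab, hb]⟩
  obtain ⟨d, hd, hmin⟩ := Finset.exists_min_image _ id hs
  simp only [Finset.mem_filter, Multiset.mem_toFinset, Polynomial.mem_roots hp,
    Polynomial.IsRoot.def, id, and_imp] at hd hmin
  obtain ⟨c, h1, h2, h3⟩ := hR.rolle_adjacent hp hd.2 ha hd.1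
    (fun c hac hcd h => absurd (hmin c h hac) (not_le.2 hcd))
  exact ⟨c, h1, h2.trans_le (hmin b hb hab), h3⟩

lemma PolyIVT.mean_value (hR : PolyIVT R) (p : Polynomial R) {a b : R} (hab : a < b) :
    ∃ c, a < c ∧ c < b ∧ p.eval b - p.eval a = p.derivative.eval c * (b - a) := by
  have hne : b - a ≠ 0 := (sub_pos.2 hab).ne'
  obtain ⟨c, h1, h2, h3⟩ := hR.rolle (p := p - Polynomial.C (p.eval a) -
    Polynomial.C ((p.eval b - p.eval a) / (b - a)) * (Polynomial.X - Polynomial.C a)) hab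
    (by simp) (by simp [hne])
  refine ⟨c, h1, h2, ?_⟩
  simp only [Polynomial.derivative_sub, Polynomial.derivative_C, Polynomial.derivative_mul,
    Polynomial.derivative_X, sub_zero, zero_mul, zero_add, mul_one, Polynomial.eval_sub,
    Polynomial.eval_C, sub_eq_zero] at h3
  rw [h3, div_mul_cancel₀ _ hne]

lemma exists_forall_ge_le_eval (p : Polynomial R) (hp : 0 < p.leadingCoeff) :
    ∃ M ε : R, 0 < ε ∧ ∀ y, M ≤ y → ε ≤ p.eval y := by
  induction hn : p.natDegree generalizing p with
  | zero =>
    rw [Polynomial.natDegree_eq_zero] at hn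
    obtain ⟨c, rfl⟩ := hn
    exact ⟨0, c, by simpa using hp, by simp⟩
  | succ n ih =>
    have hq : p.divX.natDegree = n := by rw [Polynomial.natDegree_divX_eq_natDegree_tsub_one, hn]; rfl
    have hlc : p.divX.leadingCoeff = p.leadingCoeff := by
      rw [Polynomial.leadingCoeff, hq, Polynomial.coeff_divX, Polynomial.leadingCoeff, hn]
    obtain ⟨M, ε, hε, hM⟩ := ih p.divX (hlc ▸ hp) hq
    refine ⟨max (max M 1) ((ε + |p.coeff 0|) / ε), ε, hε, fun y hy => ?_⟩
    simp only [max_le_iff] at hy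
    obtain ⟨⟨h1, h2⟩, h3⟩ := hy
    rw [div_le_iff₀ hε] at h3
    conv_rhs => rw [← Polynomial.divX_mul_X_add p]
    simp only [Polynomial.eval_add, Polynomial.eval_mul, Polynomial.eval_X, Polynomial.eval_C]
    have h4 := hM y h1
    have h5 : ε * y ≤ p.divX.eval y * y := mul_le_mul_of_nonneg_right h4 (by linarith)
    have := neg_abs_le (p.coeff 0)
    linarith

lemma exists_gt_sign_eval (p : Polynomial R) (a : R) :
    ∃ y, a < y ∧ SignType.sign (p.eval y) = SignType.sign p.leadingCoeff := by
  rcases lt_trichotomy p.leadingCoeff 0 with h | h | h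
  · obtain ⟨M, ε, hε, hM⟩ := exists_forall_ge_le_eval (-p) (by simpa using h)
    refine ⟨max M (a + 1), lt_max_of_lt_right (lt_add_one a), ?_⟩
    have := hM (max M (a + 1)) (le_max_left _ _)
    rw [Polynomial.eval_neg] at this
    rw [sign_neg h, sign_neg (by linarith)]
  · rw [Polynomial.leadingCoeff_eq_zero] at h
    exact ⟨a + 1, lt_add_one a, by simp [h]⟩
  · obtain ⟨M, ε, hε, hM⟩ := exists_forall_ge_le_eval p h
    refine ⟨max M (a + 1), lt_max_of_lt_right (lt_add_one a), ?_⟩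
    have := hM (max M (a + 1)) (le_max_left _ _)
    rw [sign_pos h, sign_pos (by linarith)]

lemma exists_lt_sign_eval (p : Polynomial R) (a : R) :
    ∃ y, y < a ∧ SignType.sign (p.eval y) =
      (-1) ^ p.natDegree * SignType.sign p.leadingCoeff := by
  obtain ⟨y, hy, h⟩ := exists_gt_sign_eval (p.comp (-Polynomial.X)) (-a)
  refine ⟨-y, by linarith, ?_⟩
  have h1 : (p.comp (-Polynomial.X)).leadingCoeff = (-1) ^ p.natDegree * p.leadingCoeff := by
    rw [Polynomial.leadingCoeff_comp (by simp)]; simp [mul_comm]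
  rw [h1, sign_mul, sign_pow] at h
  simpa [Polynomial.eval_comp] using h

lemma sign_eq_of_mul_pos {a b : R} (h : 0 < a * b) : SignType.sign a = SignType.sign b := by
  rcases mul_pos_iff.1 h with ⟨h1, h2⟩ | ⟨h1, h2⟩
  · rw [sign_pos h1, sign_pos h2]
  · rw [sign_neg h1, sign_neg h2]

lemma PolyIVT.sign_eq (hR : PolyIVT R) {p : Polynomial R} {a b : R} (hab : a ≤ b)
    (h : ∀ c, a ≤ c → c ≤ b → p.eval c ≠ 0) :
    SignType.sign (p.eval a) = SignType.sign (p.eval b) :=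
  sign_eq_of_mul_pos (hR.eval_mul_eval_pos hab h)

/-- If the derivative has no zero on `[a, b)`, then `p b - p a` has the sign of `p' a`. -/
lemma PolyIVT.sign_sub_of_left (hR : PolyIVT R) {p : Polynomial R} {a b : R} (hab : a < b)
    (h : ∀ c, a ≤ c → c < b → p.derivative.eval c ≠ 0) :
    SignType.sign (p.eval b - p.eval a) = SignType.sign (p.derivative.eval a) := by
  obtain ⟨c, h1, h2, h3⟩ := hR.mean_value p hab
  rw [h3, sign_mul, sign_pos (sub_pos.2 hab), mul_one]
  exact (hR.sign_eq h1.le fun d hd hd' => h d hd (hd'.trans_lt h2)).symm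

/-- If the derivative has no zero on `(a, b]`, then `p b - p a` has the sign of `p' b`. -/
lemma PolyIVT.sign_sub_of_right (hR : PolyIVT R) {p : Polynomial R} {a b : R} (hab : a < b)
    (h : ∀ c, a < c → c ≤ b → p.derivative.eval c ≠ 0) :
    SignType.sign (p.eval b - p.eval a) = SignType.sign (p.derivative.eval b) := by
  obtain ⟨c, h1, h2, h3⟩ := hR.mean_value p hab
  rw [h3, sign_mul, sign_pos (sub_pos.2 hab), mul_one]
  exact hR.sign_eq h2.le fun d hd hd' => h d (h1.trans_le hd) hd'

end Univariate

section Matching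

variable {R R' : Type*} [Field R] [LinearOrder R] [Field R'] [LinearOrder R']

/-- A family of pairs of polynomials over two ordered fields with the same degrees and signs of
leading coefficients, stable under derivatives and remainders. -/
structure GoodFamily (E : Set (Polynomial R × Polynomial R')) : Prop where
  natDegree_eq : ∀ e ∈ E, e.1.natDegree = e.2.natDegree
  sign_leadingCoeff : ∀ e ∈ E,
    SignType.sign e.1.leadingCoeff = SignType.sign e.2.leadingCoeff
  derivative_mem : ∀ e ∈ E, 0 < e.1.natDegree →
    ((e.1.derivative, e.2.derivative) : Polynomial R × Polynomial R') ∈ E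
  exists_rem : ∀ e ∈ E, ∀ q ∈ E, 0 < q.1.natDegree → q.1.natDegree ≤ e.1.natDegree →
    ∃ r ∈ E, r.1.natDegree < q.1.natDegree ∧
      (∀ y, q.1.eval y = 0 → SignType.sign (r.1.eval y) = SignType.sign (e.1.eval y)) ∧
      (∀ y, q.2.eval y = 0 → SignType.sign (r.2.eval y) = SignType.sign (e.2.eval y))

/-- `y` and `y'` have the same position relative to the two coordinates of the pairs in `C`. -/
def SamePos (C : Set (R × R')) (y : R) (y' : R') : Prop :=
  ∀ u ∈ C, (u.1 < y ↔ u.2 < y') ∧ (y < u.1 ↔ y' < u.2)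

/-- `C` is an order isomorphism between the zeros of the nonzero first components of `E` and the
zeros of the nonzero second components, which determines the signs of all members of `E`. -/
structure Matching (E : Set (Polynomial R × Polynomial R')) (C : Set (R × R')) : Prop where
  finite : C.Finite
  mono : ∀ u ∈ C, ∀ v ∈ C, u.1 < v.1 ↔ u.2 < v.2
  root : ∀ u ∈ C, ∃ e ∈ E, e.1 ≠ 0 ∧ e.1.eval u.1 = 0
  cover : ∀ e ∈ E, e.1 ≠ 0 → ∀ y, e.1.eval y = 0 → ∃ u ∈ C, u.1 = y
  cover' : ∀ e ∈ E, e.2 ≠ 0 → ∀ y, e.2.eval y = 0 → ∃ u ∈ C, u.2 = y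
  sign : ∀ y y', SamePos C y y' → ∀ e ∈ E,
    SignType.sign (e.1.eval y) = SignType.sign (e.2.eval y')

lemma samePos_of_mem {C : Set (R × R')} (h : ∀ u ∈ C, ∀ v ∈ C, u.1 < v.1 ↔ u.2 < v.2)
    {u : R × R'} (hu : u ∈ C) : SamePos C u.1 u.2 :=
  fun v hv => ⟨h v hv u hu, h u hu v hv⟩

lemma SamePos.eq_iff {C : Set (R × R')} {y : R} {y' : R'} (h : SamePos C y y') {u : R × R'}
    (hu : u ∈ C) : u.1 = y ↔ u.2 = y' := by
  have := h u hu
  constructor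
  · intro h1
    refine le_antisymm (not_lt.1 fun h2 => ?_) (not_lt.1 fun h2 => ?_)
    · exact (this.2.2 h2).ne h1.symm
    · exact (this.1.2 h2).ne h1
  · intro h1
    refine le_antisymm (not_lt.1 fun h2 => ?_) (not_lt.1 fun h2 => ?_)
    · exact (this.2.1 h2).ne h1.symm
    · exact (this.1.1 h2).ne h1

lemma GoodFamily.ne_zero_iff {E : Set (Polynomial R × Polynomial R')} (hE : GoodFamily E)
    {e : Polynomial R × Polynomial R'} (he : e ∈ E) : e.1 ≠ 0 ↔ e.2 ≠ 0 := by
  rw [← Polynomial.leadingCoeff_ne_zero, ← Polynomial.leadingCoeff_ne_zero, ← sign_ne_zero,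
    hE.sign_leadingCoeff e he, sign_ne_zero]

lemma GoodFamily.swap {E : Set (Polynomial R × Polynomial R')} (hE : GoodFamily E) :
    GoodFamily (R := R') (R' := R) {e | (e.2, e.1) ∈ E} := by
  refine ⟨?_, ?_, ?_, ?_⟩
  · intro e he
    exact (hE.natDegree_eq (e.2, e.1) he).symm
  · intro e he
    exact (hE.sign_leadingCoeff (e.2, e.1) he).symm
  · intro e he h
    have h1 : e.2.natDegree = e.1.natDegree := hE.natDegree_eq (e.2, e.1) he
    exact hE.derivative_mem (e.2, e.1) he (h1 ▸ h)
  · intro e he q hq h1 h2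
    have h3 : e.2.natDegree = e.1.natDegree := hE.natDegree_eq (e.2, e.1) he
    have h4 : q.2.natDegree = q.1.natDegree := hE.natDegree_eq (q.2, q.1) hq
    obtain ⟨⟨r, r'⟩, hr, h5, h6, h7⟩ := hE.exists_rem (e.2, e.1) he (q.2, q.1) hq
      (by rw [h4]; exact h1) (by rw [h3, h4]; exact h2)
    have h8 : r.natDegree = r'.natDegree := hE.natDegree_eq (r, r') hr
    refine ⟨(r', r), hr, ?_, h7, h6⟩
    simp only at h5 ⊢
    omega

lemma SamePos.swap {C : Set (R × R')} {y : R} {y' : R'} (h : SamePos C y y') :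
    SamePos (R := R') (R' := R) {u | (u.2, u.1) ∈ C} y' y :=
  fun u hu => ⟨(h (u.2, u.1) hu).1.symm, (h (u.2, u.1) hu).2.symm⟩

lemma SamePos.of_swap {C : Set (R × R')} {y : R} {y' : R'}
    (h : SamePos (R := R') (R' := R) {u | (u.2, u.1) ∈ C} y' y) : SamePos C y y' :=
  fun u hu => ⟨(h (u.2, u.1) hu).1.symm, (h (u.2, u.1) hu).2.symm⟩

lemma Matching.swap {E : Set (Polynomial R × Polynomial R')} {C : Set (R × R')}
    (hE : ∀ e ∈ E, e.1 ≠ 0 ↔ e.2 ≠ 0) (hC : Matching E C) :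
    Matching (R := R') (R' := R) {e | (e.2, e.1) ∈ E} {u | (u.2, u.1) ∈ C} := by
  refine ⟨hC.finite.preimage Prod.swap_injective.injOn, ?_, ?_, ?_, ?_, ?_⟩
  · intro u hu v hv
    exact (hC.mono (u.2, u.1) hu (v.2, v.1) hv).symm
  · intro u hu
    obtain ⟨⟨e, e'⟩, he, h1, h2⟩ := hC.root (u.2, u.1) hu
    refine ⟨(e', e), he, (hE (e, e') he).1 h1, ?_⟩
    have h3 : SignType.sign (e.eval u.2) = SignType.sign (e'.eval u.1) :=
      hC.sign _ _ (samePos_of_mem hC.mono hu) (e, e') he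
    simp only at h2
    rw [h2, sign_zero] at h3
    exact sign_eq_zero_iff.1 h3.symm
  · intro e he h y hy
    obtain ⟨u, hu, h⟩ := hC.cover' (e.2, e.1) he h y hy
    exact ⟨(u.2, u.1), hu, h⟩
  · intro e he h y hy
    obtain ⟨u, hu, h⟩ := hC.cover (e.2, e.1) he h y hy
    exact ⟨(u.2, u.1), hu, h⟩
  · intro y y' h e he
    exact (hC.sign y' y h.of_swap (e.2, e.1) he).symm

variable [IsStrictOrderedRing R] [IsStrictOrderedRing R']

lemma exists_samePos {C : Set (R × R')} (hfin : C.Finite)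
    (h : ∀ u ∈ C, ∀ v ∈ C, u.1 < v.1 ↔ u.2 < v.2) (y : R) : ∃ y', SamePos C y y' := by
  by_cases hy : ∃ u ∈ C, u.1 = y
  · obtain ⟨u, hu, rfl⟩ := hy
    exact ⟨u.2, samePos_of_mem h hu⟩
  · push Not at hy
    classical
    obtain ⟨y', h1, h2⟩ := Order.exists_between_finsets
      ((hfin.toFinset.filter (fun u => u.1 < y)).image Prod.snd)
      ((hfin.toFinset.filter (fun u => y < u.1)).image Prod.snd) (by
        simp only [Finset.mem_image, Finset.mem_filter, Set.Finite.mem_toFinset]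
        rintro _ ⟨u, ⟨hu, hu'⟩, rfl⟩ _ ⟨v, ⟨hv, hv'⟩, rfl⟩
        exact (h u hu v hv).1 (hu'.trans hv'))
    simp only [Finset.mem_image, Finset.mem_filter, Set.Finite.mem_toFinset,
      forall_exists_index, and_imp] at h1 h2
    refine ⟨y', fun u hu => ?_⟩
    rcases lt_or_gt_of_ne (hy u hu) with h3 | h3
    · have := h1 _ u hu h3 rfl
      exact ⟨iff_of_true h3 this, iff_of_false h3.le.not_gt this.le.not_gt⟩
    · have := h2 _ u hu h3 rfl
      exact ⟨iff_of_false h3.le.not_gt this.le.not_gt, iff_of_true h3 this⟩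

lemma exists_right_witness {C : Set (R × R')} (hfin : C.Finite)
    (hmono : ∀ u ∈ C, ∀ v ∈ C, u.1 < v.1 ↔ u.2 < v.2) {y : R} {y' : R'} (hy : SamePos C y y')
    {p : Polynomial R} {p' : Polynomial R'}
    (hlc : SignType.sign p.leadingCoeff = SignType.sign p'.leadingCoeff)
    (hs : ∀ u ∈ C, SignType.sign (p.eval u.1) = SignType.sign (p'.eval u.2)) :
    ∃ t t', y < t ∧ y' < t' ∧ SignType.sign (p.eval t) = SignType.sign (p'.eval t') ∧
      ∀ u ∈ C, y < u.1 → t ≤ u.1 ∧ t' ≤ u.2 := by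
  by_cases hU : ∃ u ∈ C, y < u.1
  · obtain ⟨u, ⟨hu, hyu⟩, hmin⟩ := Set.exists_min_image {u ∈ C | y < u.1} Prod.fst
      (hfin.subset (Set.sep_subset _ _)) hU
    refine ⟨u.1, u.2, hyu, (hy u hu).2.1 hyu, hs u hu, fun v hv hyv => ?_⟩
    have h1 := hmin v ⟨hv, hyv⟩
    exact ⟨h1, not_lt.1 fun h2 => absurd ((hmono v hv u hu).2 h2) (not_lt.2 h1)⟩
  · push Not at hU
    obtain ⟨t, ht, h1⟩ := exists_gt_sign_eval p y
    obtain ⟨t', ht', h2⟩ := exists_gt_sign_eval p' y'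
    exact ⟨t, t', ht, ht', by rw [h1, h2, hlc], fun u hu h => absurd h (not_lt.2 (hU u hu))⟩

lemma exists_left_witness {C : Set (R × R')} (hfin : C.Finite)
    (hmono : ∀ u ∈ C, ∀ v ∈ C, u.1 < v.1 ↔ u.2 < v.2) {y : R} {y' : R'} (hy : SamePos C y y')
    {p : Polynomial R} {p' : Polynomial R'} (hdeg : p.natDegree = p'.natDegree)
    (hlc : SignType.sign p.leadingCoeff = SignType.sign p'.leadingCoeff)
    (hs : ∀ u ∈ C, SignType.sign (p.eval u.1) = SignType.sign (p'.eval u.2)) :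
    ∃ t t', t < y ∧ t' < y' ∧ SignType.sign (p.eval t) = SignType.sign (p'.eval t') ∧
      ∀ u ∈ C, u.1 < y → u.1 ≤ t ∧ u.2 ≤ t' := by
  by_cases hU : ∃ u ∈ C, u.1 < y
  · obtain ⟨u, ⟨hu, hyu⟩, hmax⟩ := Set.exists_max_image {u ∈ C | u.1 < y} Prod.fst
      (hfin.subset (Set.sep_subset _ _)) hU
    refine ⟨u.1, u.2, hyu, (hy u hu).1.1 hyu, hs u hu, fun v hv hyv => ?_⟩
    have h1 := hmax v ⟨hv, hyv⟩
    exact ⟨h1, not_lt.1 fun h2 => absurd ((hmono u hu v hv).2 h2) (not_lt.2 h1)⟩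
  · push Not at hU
    obtain ⟨t, ht, h1⟩ := exists_lt_sign_eval p y
    obtain ⟨t', ht', h2⟩ := exists_lt_sign_eval p' y'
    exact ⟨t, t', ht, ht', by rw [h1, h2, hlc, hdeg],
      fun u hu h => absurd h (not_lt.2 (hU u hu))⟩

lemma natDegree_pos_of_eval_eq_zero {p : Polynomial R} (hp : p ≠ 0) {y : R} (hy : p.eval y = 0) :
    0 < p.natDegree := by
  by_contra h
  obtain ⟨c, rfl⟩ := Polynomial.natDegree_eq_zero.1 (Nat.eq_zero_of_not_pos h)
  simp_all

lemma derivative_ne_zero_of_natDegree_pos {p : Polynomial R} (hp : 0 < p.natDegree) :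
    p.derivative ≠ 0 :=
  fun h => hp.ne' (Polynomial.derivative_eq_zero.1 h)

section Insert

variable {E : Set (Polynomial R × Polynomial R')} {C : Set (R × R')}
  {e : Polynomial R × Polynomial R'}

lemma Matching.sign_eval_of_mem (hE : GoodFamily (insert e E))
    (hmax : ∀ q ∈ E, q.1.natDegree ≤ e.1.natDegree) (hC : Matching E C) {u : R × R'}
    (hu : u ∈ C) : SignType.sign (e.1.eval u.1) = SignType.sign (e.2.eval u.2) := by
  obtain ⟨q, hq, hq0, hqu⟩ := hC.root u hu
  obtain ⟨r, hr, h1, h2, h3⟩ := hE.exists_rem e (Set.mem_insert _ _) q (Set.mem_insert_of_mem _ hq)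
    (natDegree_pos_of_eval_eq_zero hq0 hqu) (hmax q hq)
  have hrE : r ∈ E := hr.resolve_left (by rintro rfl; exact absurd (hmax q hq) (not_le.2 h1))
  have h4 := hC.sign _ _ (samePos_of_mem hC.mono hu) q hq
  rw [hqu, sign_zero] at h4
  rw [← h2 _ hqu, ← h3 _ (sign_eq_zero_iff.1 h4.symm)]
  exact hC.sign _ _ (samePos_of_mem hC.mono hu) r hrE

lemma GoodFamily.derivative_mem_of_insert (hE : GoodFamily (insert e E))
    (he : 0 < e.1.natDegree) :
    ((e.1.derivative, e.2.derivative) : Polynomial R × Polynomial R') ∈ E := by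
  refine (hE.derivative_mem e (Set.mem_insert _ _) he).resolve_left fun h => ?_
  have h1 := congrArg (fun q : Polynomial R × Polynomial R' => q.1.natDegree) h
  simp only at h1
  have h2 := Polynomial.natDegree_derivative_lt he.ne'
  omega

lemma Matching.exists_root (hR : PolyIVT R) (hR' : PolyIVT R') (hE : GoodFamily (insert e E))
    (hmax : ∀ q ∈ E, q.1.natDegree ≤ e.1.natDegree) (hC : Matching E C) (he : e.1 ≠ 0)
    {y : R} (hy : e.1.eval y = 0) (hyC : ∀ u ∈ C, u.1 ≠ y) :
    ∃ y', e.2.eval y' = 0 ∧ SamePos C y y' := by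
  have hpos := natDegree_pos_of_eval_eq_zero he hy
  have hdE := hE.derivative_mem_of_insert hpos
  have hd0 := derivative_ne_zero_of_natDegree_pos hpos
  have hs : ∀ u ∈ C, SignType.sign (e.1.eval u.1) = SignType.sign (e.2.eval u.2) :=
    fun u hu => hC.sign_eval_of_mem hE hmax hu
  obtain ⟨z, hz⟩ := exists_samePos hC.finite hC.mono y
  have hdeg := hE.natDegree_eq e (Set.mem_insert _ _)
  have hlc := hE.sign_leadingCoeff e (Set.mem_insert _ _)
  obtain ⟨a, a', h1, h2, h3, h4⟩ := exists_left_witness hC.finite hC.mono hz hdeg hlc hs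
  obtain ⟨b, b', h5, h6, h7, h8⟩ := exists_right_witness hC.finite hC.mono hz hlc hs
  have hsa := hR.sign_sub_of_right (p := e.1) h1 (fun c hac hcy h => by
    obtain ⟨u, hu, rfl⟩ := hC.cover _ hdE hd0 c h
    exact absurd (h4 u hu (lt_of_le_of_ne hcy (hyC u hu))).1 (not_le.2 hac))
  have hsb := hR.sign_sub_of_left (p := e.1) h5 (fun c hyc hcb h => by
    obtain ⟨u, hu, rfl⟩ := hC.cover _ hdE hd0 c h
    exact absurd (h8 u hu (lt_of_le_of_ne hyc (hyC u hu).symm)).1 (not_le.2 hcb))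
  rw [hy, zero_sub, Left.sign_neg, h3] at hsa
  rw [hy, sub_zero, h7] at hsb
  have hdy : e.1.derivative.eval y ≠ 0 := fun h => by
    obtain ⟨u, hu, h9⟩ := hC.cover _ hdE hd0 y h
    exact hyC u hu h9
  have hneg : e.2.eval a' * e.2.eval b' < 0 := by
    rw [← sign_eq_neg_one_iff, sign_mul, hsb, ← hsa]
    have : e.2.eval a' ≠ 0 := by
      intro h
      rw [h, sign_zero, eq_comm, neg_zero, sign_eq_zero_iff] at hsa
      exact hdy hsa
    rcases lt_or_gt_of_ne this with h | h
    · rw [sign_neg h]; rfl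
    · rw [sign_pos h]; rfl
  obtain ⟨w, hw1, hw2, hw3⟩ := hR' e.2 a' b' (h2.trans h6) hneg
  refine ⟨w, hw3, fun u hu => ?_⟩
  rcases lt_or_gt_of_ne (hyC u hu) with h | h
  · have := (h4 u hu h).2.trans_lt hw1
    exact ⟨iff_of_true h this, iff_of_false h.le.not_gt this.le.not_gt⟩
  · have := hw2.trans_le (h8 u hu h).2
    exact ⟨iff_of_false h.le.not_gt this.le.not_gt, iff_of_true h this⟩

/-- The pairs of zeros of `e` in corresponding gaps of `C`. -/
def newRoots (C : Set (R × R')) (e : Polynomial R × Polynomial R') : Set (R × R') :=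
  {v | e.1.eval v.1 = 0 ∧ e.2.eval v.2 = 0 ∧ (∀ u ∈ C, u.1 ≠ v.1) ∧ SamePos C v.1 v.2}

lemma Matching.mono_newRoots (hR : PolyIVT R) (hR' : PolyIVT R') (hE : GoodFamily (insert e E))
    (hC : Matching E C) (he : e.1 ≠ 0) {v w : R × R'} (hv : v ∈ newRoots C e)
    (hw : w ∈ newRoots C e) : v.1 < w.1 ↔ v.2 < w.2 := by
  have hpos := natDegree_pos_of_eval_eq_zero he hv.1
  have hdE := hE.derivative_mem_of_insert hpos
  constructor
  · intro h
    obtain ⟨c, h1, h2, h3⟩ := hR.rolle h hv.1 hw.1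
    obtain ⟨u, hu, rfl⟩ := hC.cover _ hdE (derivative_ne_zero_of_natDegree_pos hpos) c h3
    exact ((hv.2.2.2 u hu).2.1 h1).trans ((hw.2.2.2 u hu).1.1 h2)
  · intro h
    obtain ⟨c, h1, h2, h3⟩ := hR'.rolle h hv.2.1 hw.2.1
    rw [hE.natDegree_eq e (Set.mem_insert _ _)] at hpos
    obtain ⟨u, hu, rfl⟩ := hC.cover' _ hdE (derivative_ne_zero_of_natDegree_pos hpos) c h3
    exact ((hv.2.2.2 u hu).2.2 h1).trans ((hw.2.2.2 u hu).1.2 h2)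

lemma Matching.insert_pair (hR : PolyIVT R) (hR' : PolyIVT R') (hE : GoodFamily (insert e E))
    (hmax : ∀ q ∈ E, q.1.natDegree ≤ e.1.natDegree) (hC : Matching E C) (he : e.1 ≠ 0) :
    Matching (insert e E) (C ∪ newRoots C e) := by
  have heE : e ∈ insert e E := Set.mem_insert _ _
  have he' : e.2 ≠ 0 := (hE.ne_zero_iff heE).1 he
  have hfin : (C ∪ newRoots C e).Finite := by
    refine hC.finite.union (((e.1.roots.toFinset ×ˢ e.2.roots.toFinset).finite_toSet).subset ?_)
    rintro ⟨v, v'⟩ hv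
    simpa [he, he'] using ⟨hv.1, hv.2.1⟩
  have hmono : ∀ u ∈ C ∪ newRoots C e, ∀ v ∈ C ∪ newRoots C e, u.1 < v.1 ↔ u.2 < v.2 := by
    rintro u (hu | hu) v (hv | hv)
    · exact hC.mono u hu v hv
    · exact (hv.2.2.2 u hu).1
    · exact (hu.2.2.2 v hv).2
    · exact hC.mono_newRoots hR hR' hE he hu hv
  have hcov : ∀ y, e.1.eval y = 0 → ∃ u ∈ C ∪ newRoots C e, u.1 = y := by
    intro y hy
    by_cases hyC : ∃ u ∈ C, u.1 = y
    · obtain ⟨u, hu, h⟩ := hyC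
      exact ⟨u, Or.inl hu, h⟩
    · push Not at hyC
      obtain ⟨y', h1, h2⟩ := hC.exists_root hR hR' hE hmax he hy hyC
      exact ⟨(y, y'), Or.inr ⟨hy, h1, hyC, h2⟩, rfl⟩
  have hcov' : ∀ y, e.2.eval y = 0 → ∃ u ∈ C ∪ newRoots C e, u.2 = y := by
    intro y hy
    by_cases hyC : ∃ u ∈ C, u.2 = y
    · obtain ⟨u, hu, h⟩ := hyC
      exact ⟨u, Or.inl hu, h⟩
    · push Not at hyC
      have hEs : GoodFamily (R := R') (R' := R) (insert (e.2, e.1) {q | (q.2, q.1) ∈ E}) := by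
        have h : (insert (e.2, e.1) {q | (q.2, q.1) ∈ E} : Set (Polynomial R' × Polynomial R)) =
            {q | (q.2, q.1) ∈ insert e E} := by
          ext q
          simp [Prod.ext_iff, and_comm]
        rw [h]
        exact hE.swap
      have hCs := hC.swap (fun q hq => hE.ne_zero_iff (Set.mem_insert_of_mem _ hq))
      obtain ⟨y', h1, h2⟩ := hCs.exists_root hR' hR hEs (fun q hq => by
          have h1 := hmax (q.2, q.1) hq
          rw [hE.natDegree_eq _ (Set.mem_insert_of_mem _ hq), hE.natDegree_eq _ heE] at h1
          exact h1) he' hy (fun u hu => hyC (u.2, u.1) hu)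
      have h3 : SamePos C y' y := h2.of_swap
      exact ⟨(y', y), Or.inr ⟨h1, hy, fun u hu h => hyC u hu ((h3.eq_iff hu).1 h), h3⟩, rfl⟩
  refine ⟨hfin, hmono, ?_, ?_, ?_, ?_⟩
  · rintro u (hu | hu)
    · obtain ⟨q, hq, h⟩ := hC.root u hu
      exact ⟨q, Set.mem_insert_of_mem _ hq, h⟩
    · exact ⟨e, heE, he, hu.1⟩
  · rintro q (rfl | hq) hq0 y hy
    · exact hcov y hy
    · obtain ⟨u, hu, h⟩ := hC.cover q hq hq0 y hy
      exact ⟨u, Or.inl hu, h⟩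
  · rintro q (rfl | hq) hq0 y hy
    · exact hcov' y hy
    · obtain ⟨u, hu, h⟩ := hC.cover' q hq hq0 y hy
      exact ⟨u, Or.inl hu, h⟩
  · intro y y' hyy
    have hyC : SamePos C y y' := fun u hu => hyy u (Or.inl hu)
    rintro q (rfl | hq)
    swap
    · exact hC.sign y y' hyC q hq
    have hs : ∀ u ∈ C ∪ newRoots C q,
        SignType.sign (q.1.eval u.1) = SignType.sign (q.2.eval u.2) := by
      rintro u (hu | hu)
      · exact hC.sign_eval_of_mem hE hmax hu
      · rw [hu.1, hu.2.1, sign_zero, sign_zero]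
    by_cases hy : ∃ u ∈ C ∪ newRoots C q, u.1 = y
    · obtain ⟨u, hu, rfl⟩ := hy
      rw [hs u hu, (hyy.eq_iff hu).1 rfl]
    push Not at hy
    have hy' : ∀ u ∈ C ∪ newRoots C q, u.2 ≠ y' := fun u hu h => hy u hu ((hyy.eq_iff hu).2 h)
    obtain ⟨t, t', h1, h2, h3, h4⟩ := exists_right_witness hfin hmono hyy
      (hE.sign_leadingCoeff q heE) hs
    have hclear : ∀ u ∈ C ∪ newRoots C q, ¬ (y ≤ u.1 ∧ u.1 < t) := fun u hu h =>
      absurd (h4 u hu (lt_of_le_of_ne h.1 (hy u hu).symm)).1 (not_le.2 h.2)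
    have hclear' : ∀ u ∈ C ∪ newRoots C q, ¬ (y' ≤ u.2 ∧ u.2 < t') := fun u hu h =>
      absurd (h4 u hu ((hyy u hu).2.2 (lt_of_le_of_ne h.1 (hy' u hu).symm))).2 (not_le.2 h.2)
    by_cases ht : q.1.eval t = 0
    · have ht' : q.2.eval t' = 0 := by
        rw [ht, sign_zero] at h3
        exact sign_eq_zero_iff.1 h3.symm
      have hpos := natDegree_pos_of_eval_eq_zero he ht
      have hpos' := natDegree_pos_of_eval_eq_zero he' ht'
      have hdE := hE.derivative_mem_of_insert hpos
      have h5 := hR.sign_sub_of_left h1 (fun c hc hc' h => by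
        obtain ⟨u, hu, rfl⟩ := hC.cover _ hdE (derivative_ne_zero_of_natDegree_pos hpos) c h
        exact hclear u (Or.inl hu) ⟨hc, hc'⟩)
      have h6 := hR'.sign_sub_of_left h2 (fun c hc hc' h => by
        obtain ⟨u, hu, rfl⟩ := hC.cover' _ hdE (derivative_ne_zero_of_natDegree_pos hpos') c h
        exact hclear' u (Or.inl hu) ⟨hc, hc'⟩)
      rw [ht, zero_sub, Left.sign_neg] at h5
      rw [ht', zero_sub, Left.sign_neg] at h6
      have h7 := hC.sign y y' hyC _ hdE
      simp only at h7
      rw [← neg_inj, h5, h6, h7]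
    · have ht' : q.2.eval t' ≠ 0 := by
        rw [← sign_ne_zero, ← h3, sign_ne_zero]; exact ht
      rw [hR.sign_eq h1.le (fun c hc hc' h => ?_), h3, ← hR'.sign_eq h2.le (fun c hc hc' h => ?_)]
      · rcases hc'.eq_or_lt with rfl | hc'
        · exact ht' h
        obtain ⟨u, hu, rfl⟩ := hcov' c h
        exact hclear' u hu ⟨hc, hc'⟩
      · rcases hc'.eq_or_lt with rfl | hc'
        · exact ht h
        obtain ⟨u, hu, rfl⟩ := hcov c h
        exact hclear u hu ⟨hc, hc'⟩

lemma Matching.insert_zero (hE : GoodFamily (insert e E)) (hC : Matching E C)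
    (he : e.1 = 0) : Matching (insert e E) C := by
  have he' : e.2 = 0 := by
    have := hE.ne_zero_iff (Set.mem_insert _ _)
    tauto
  refine ⟨hC.finite, hC.mono, fun u hu => ?_, ?_, ?_, ?_⟩
  · obtain ⟨q, hq, h⟩ := hC.root u hu
    exact ⟨q, Set.mem_insert_of_mem _ hq, h⟩
  · rintro q (rfl | hq) hq0
    · exact absurd he hq0
    · exact hC.cover q hq hq0
  · rintro q (rfl | hq) hq0
    · exact absurd he' hq0
    · exact hC.cover' q hq hq0
  · rintro y y' h q (rfl | hq)
    · simp [he, he']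
    · exact hC.sign y y' h q hq

end Insert

lemma GoodFamily.of_insert {E : Set (Polynomial R × Polynomial R')}
    {e : Polynomial R × Polynomial R'} (heE : e ∉ E) (hE : GoodFamily (insert e E))
    (hmax : ∀ q ∈ E, q.1.natDegree ≤ e.1.natDegree) : GoodFamily E where
  natDegree_eq q hq := hE.natDegree_eq q (Set.mem_insert_of_mem _ hq)
  sign_leadingCoeff q hq := hE.sign_leadingCoeff q (Set.mem_insert_of_mem _ hq)
  derivative_mem q hq h := by
    refine (hE.derivative_mem q (Set.mem_insert_of_mem _ hq) h).resolve_left fun h1 => ?_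
    have h2 := Polynomial.natDegree_derivative_lt h.ne'
    have h3 := hmax q hq
    rw [← h1] at h3
    simp only at h3
    omega
  exists_rem q hq p hp h1 h2 := by
    obtain ⟨r, hr, h3, h4⟩ := hE.exists_rem q (Set.mem_insert_of_mem _ hq) p
      (Set.mem_insert_of_mem _ hp) h1 h2
    refine ⟨r, hr.resolve_left ?_, h3, h4⟩
    rintro rfl
    exact absurd (hmax p hp) (not_le.2 h3)

lemma GoodFamily.exists_matching (hR : PolyIVT R) (hR' : PolyIVT R')
    (E : Finset (Polynomial R × Polynomial R')) (hE : GoodFamily (E : Set (Polynomial R × Polynomial R'))) :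
    ∃ C, Matching (E : Set (Polynomial R × Polynomial R')) C := by
  classical
  revert hE
  refine Finset.induction_on_max_value (fun e : Polynomial R × Polynomial R' => e.1.natDegree) E
    ?_ ?_
  · exact fun _ => ⟨∅, by constructor <;> simp⟩
  · intro e E heE hmax ih hE
    rw [Finset.coe_insert] at hE ⊢
    obtain ⟨C, hC⟩ := ih (hE.of_insert (by simpa using heE) hmax)
    by_cases he : e.1 = 0
    · exact ⟨C, hC.insert_zero hE he⟩
    · exact ⟨_, hC.insert_pair hR hR' hE hmax he⟩

lemma GoodFamily.exists_sign_eq (hR : PolyIVT R) (hR' : PolyIVT R')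
    (E : Finset (Polynomial R × Polynomial R')) (hE : GoodFamily (E : Set (Polynomial R × Polynomial R'))) (y : R) :
    ∃ y' : R', ∀ e ∈ E, SignType.sign (e.1.eval y) = SignType.sign (e.2.eval y') := by
  obtain ⟨C, hC⟩ := hE.exists_matching hR hR'
  obtain ⟨y', h⟩ := exists_samePos hC.finite hC.mono y
  exact ⟨y', hC.sign y y' h⟩

end Matching

lemma exists_finset_closed {X : Type*} (δ : X → ℕ) (F : X → X → Finset X)
    (hF : ∀ p q, 0 < δ q → δ q ≤ δ p → ∀ r ∈ F p q, δ r < δ q) (P : Finset X) :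
    ∃ D : Finset X, P ⊆ D ∧ ∀ p ∈ D, ∀ q ∈ D, 0 < δ q → δ q ≤ δ p → F p q ⊆ D := by
  classical
  have key : ∀ k, ∃ D : Finset X, P ⊆ D ∧
      ∀ p ∈ D, ∀ q ∈ D, P.sup δ - k < δ q → δ q ≤ δ p → F p q ⊆ D := by
    intro k
    induction k with
    | zero =>
      exact ⟨P, subset_rfl, fun p _ q hq h => absurd (Finset.le_sup (f := δ) hq) (not_le.2 h)⟩
    | succ k ih =>
      obtain ⟨D, hPD, hD⟩ := ih
      by_cases hk : P.sup δ ≤ k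
      · refine ⟨D, hPD, fun p hp q hq h => hD p hp q hq (by omega)⟩
      have hnew : ∀ r ∈ ((D ×ˢ D).filter fun u => δ u.2 = P.sup δ - k ∧ δ u.2 ≤ δ u.1).biUnion
          fun u => F u.1 u.2, δ r < P.sup δ - k := by
        intro r hr
        simp only [Finset.mem_biUnion, Finset.mem_filter] at hr
        obtain ⟨u, ⟨-, h1, h2⟩, h3⟩ := hr
        exact h1 ▸ hF u.1 u.2 (by omega) h2 r h3
      refine ⟨D ∪ ((D ×ˢ D).filter fun u => δ u.2 = P.sup δ - k ∧ δ u.2 ≤ δ u.1).biUnion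
          fun u => F u.1 u.2, hPD.trans Finset.subset_union_left, ?_⟩
      intro p hp q hq h1 h2
      have hpD : p ∈ D := (Finset.mem_union.1 hp).resolve_right fun h => by
        have := hnew p h
        omega
      have hqD : q ∈ D := (Finset.mem_union.1 hq).resolve_right fun h => by
        have := hnew q h
        omega
      by_cases h3 : δ q = P.sup δ - k
      · refine subset_trans ?_ Finset.subset_union_right
        intro r hr
        simp only [Finset.mem_biUnion, Finset.mem_filter, Finset.mem_product]
        exact ⟨(p, q), ⟨⟨hpD, hqD⟩, h3, h2⟩, hr⟩
      · exact (hD p hpD q hqD (by omega) h2).trans Finset.subset_union_left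
  obtain ⟨D, h1, h2⟩ := key (P.sup δ)
  exact ⟨D, h1, fun p hp q hq h => h2 p hp q hq (by omega)⟩

section Lifting

variable {B : Type*} [CommRing B]

lemma exists_even_pow_mul_eq_add (q : Polynomial B) (hq : 0 < q.natDegree) (p : Polynomial B) :
    ∃ r : Polynomial B, r.natDegree < q.natDegree ∧ ∃ (k : ℕ) (s : Polynomial B),
      Polynomial.C ((q.leadingCoeff ^ 2) ^ k) * p = q * s + r := by
  induction h : p.natDegree using Nat.strong_induction_on generalizing p with
  | _ n ih =>
    subst h
    by_cases hpq : p.natDegree < q.natDegree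
    · exact ⟨p, hpq, 0, 0, by simp⟩
    obtain ⟨d, hd⟩ := Nat.exists_eq_add_of_le (not_lt.1 hpq)
    set p₁ := Polynomial.C (q.leadingCoeff ^ 2) * p -
      q * (Polynomial.C (q.leadingCoeff * p.leadingCoeff) * Polynomial.X ^ d) with hp₁
    have hle : p₁.natDegree ≤ p.natDegree := by
      refine (Polynomial.natDegree_sub_le _ _).trans (max_le ?_ ?_)
      · exact Polynomial.natDegree_C_mul_le _ _
      · refine Polynomial.natDegree_mul_le.trans ?_
        rw [hd]
        gcongr
        exact Polynomial.natDegree_C_mul_X_pow_le _ _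
    have hcoeff : p₁.coeff p.natDegree = 0 := by
      rw [hp₁, Polynomial.coeff_sub, Polynomial.coeff_C_mul, ← mul_assoc, hd,
        Polynomial.coeff_mul_X_pow, Polynomial.coeff_mul_C, ← hd]
      simp only [Polynomial.coeff_natDegree]
      ring
    have hlt : p₁.natDegree < p.natDegree := by
      refine lt_of_le_of_ne hle fun h => ?_
      rw [← h, Polynomial.coeff_natDegree, Polynomial.leadingCoeff_eq_zero] at hcoeff
      rw [hcoeff, Polynomial.natDegree_zero] at h
      omega
    obtain ⟨r, hr, k, s, hs⟩ := ih _ hlt p₁ rfl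
    refine ⟨r, hr, k + 1, s + Polynomial.C ((q.leadingCoeff ^ 2) ^ k) *
      (Polynomial.C (q.leadingCoeff * p.leadingCoeff) * Polynomial.X ^ d), ?_⟩
    rw [pow_succ, Polynomial.C_mul, mul_assoc, eq_add_of_sub_eq hp₁.symm, mul_add, hs]
    ring

variable {R R' : Type*} [Field R] [LinearOrder R] [Field R'] [LinearOrder R']

lemma exists_map_eq_of_eraseLead_mem {D : Finset (Polynomial B)} (h0 : 0 ∈ D)
    (herase : ∀ p ∈ D, 0 < p.natDegree → p.eraseLead ∈ D) {φ : B →+* R} {φ' : B →+* R'}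
    (hφ : ∀ p ∈ D, SignType.sign (φ p.leadingCoeff) = SignType.sign (φ' p.leadingCoeff))
    (p : Polynomial B) (hp : p ∈ D) :
    ∃ q ∈ D, q.map φ = p.map φ ∧ q.map φ' = p.map φ' ∧ (q = 0 ∨ φ q.leadingCoeff ≠ 0) := by
  induction h : p.natDegree using Nat.strong_induction_on generalizing p with
  | _ n ih =>
    subst h
    by_cases hlc : φ p.leadingCoeff = 0
    · have hlc' : φ' p.leadingCoeff = 0 := by
        have := hφ p hp
        rw [hlc, sign_zero] at this
        exact sign_eq_zero_iff.1 this.symm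
      rcases Nat.eq_zero_or_pos p.natDegree with hd | hd
      · obtain ⟨c, rfl⟩ := Polynomial.natDegree_eq_zero.1 hd
        rw [Polynomial.leadingCoeff_C] at hlc hlc'
        exact ⟨0, h0, by simp [hlc], by simp [hlc'], Or.inl rfl⟩
      · obtain ⟨q, hq, h1, h2, h3⟩ := ih p.eraseLead.natDegree
          ((Polynomial.eraseLead_natDegree_le p).trans_lt (by omega)) _ (herase p hp hd) rfl
        have h4 := Polynomial.eraseLead_add_C_mul_X_pow p
        refine ⟨q, hq, h1.trans ?_, h2.trans ?_, h3⟩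
        · simpa [-Polynomial.eraseLead_add_C_mul_X_pow, hlc] using congrArg (Polynomial.map φ) h4
        · simpa [-Polynomial.eraseLead_add_C_mul_X_pow, hlc'] using congrArg (Polynomial.map φ') h4
    · exact ⟨p, hp, rfl, rfl, Or.inr hlc⟩

lemma goodFamily_image [IsStrictOrderedRing R] [IsStrictOrderedRing R']
    {rem : Polynomial B → Polynomial B → Polynomial B}
    (hrem : ∀ p q : Polynomial B, 0 < q.natDegree → (rem p q).natDegree < q.natDegree ∧
      ∃ (k : ℕ) (s : Polynomial B),
        Polynomial.C ((q.leadingCoeff ^ 2) ^ k) * p = q * s + rem p q)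
    {D : Finset (Polynomial B)} (h0 : 0 ∈ D)
    (herase : ∀ p ∈ D, 0 < p.natDegree → p.eraseLead ∈ D)
    (hder : ∀ p ∈ D, 0 < p.natDegree → p.derivative ∈ D)
    (hremD : ∀ p ∈ D, ∀ q ∈ D, 0 < q.natDegree → q.natDegree ≤ p.natDegree → rem p q ∈ D)
    {φ : B →+* R} {φ' : B →+* R'}
    (hφ : ∀ p ∈ D, SignType.sign (φ p.leadingCoeff) = SignType.sign (φ' p.leadingCoeff)) :
    GoodFamily ((fun p : Polynomial B => (p.map φ, p.map φ')) '' D) := by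
  have hne : ∀ q ∈ D, φ q.leadingCoeff ≠ 0 → φ' q.leadingCoeff ≠ 0 := by
    intro q hq h
    rw [← sign_ne_zero, ← hφ q hq, sign_ne_zero]
    exact h
  have hdeg : ∀ q ∈ D, (q = 0 ∨ φ q.leadingCoeff ≠ 0) → (q.map φ).natDegree = q.natDegree ∧
      (q.map φ').natDegree = q.natDegree := by
    rintro q hq (rfl | h)
    · simp
    · exact ⟨Polynomial.natDegree_map_of_leadingCoeff_ne_zero _ h,
        Polynomial.natDegree_map_of_leadingCoeff_ne_zero _ (hne q hq h)⟩
  refine ⟨?_, ?_, ?_, ?_⟩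
  · rintro _ ⟨p, hp, rfl⟩
    obtain ⟨q, hq, h1, h2, h3⟩ := exists_map_eq_of_eraseLead_mem h0 herase hφ p hp
    simp only [← h1, ← h2]
    rw [(hdeg q hq h3).1, (hdeg q hq h3).2]
  · rintro _ ⟨p, hp, rfl⟩
    obtain ⟨q, hq, h1, h2, h3⟩ := exists_map_eq_of_eraseLead_mem h0 herase hφ p hp
    simp only [← h1, ← h2]
    rcases h3 with rfl | h3
    · simp
    · rw [Polynomial.leadingCoeff_map_of_leadingCoeff_ne_zero _ h3,
        Polynomial.leadingCoeff_map_of_leadingCoeff_ne_zero _ (hne q hq h3)]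
      exact hφ q hq
  · rintro _ ⟨p, hp, rfl⟩ hd
    obtain ⟨q, hq, h1, h2, h3⟩ := exists_map_eq_of_eraseLead_mem h0 herase hφ p hp
    simp only [← h1, ← h2] at hd ⊢
    rw [(hdeg q hq h3).1] at hd
    exact ⟨q.derivative, hder q hq hd, by simp [Polynomial.derivative_map]⟩
  · rintro _ ⟨p, hp, rfl⟩ _ ⟨q, hq, rfl⟩ hd hle
    obtain ⟨p₁, hp₁, h1, h2, h3⟩ := exists_map_eq_of_eraseLead_mem h0 herase hφ p hp
    obtain ⟨q₁, hq₁, h4, h5, h6⟩ := exists_map_eq_of_eraseLead_mem h0 herase hφ q hq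
    simp only [← h1, ← h2, ← h4, ← h5] at hd hle ⊢
    rw [(hdeg q₁ hq₁ h6).1] at hd
    rw [(hdeg q₁ hq₁ h6).1, (hdeg p₁ hp₁ h3).1] at hle
    obtain ⟨h7, k, s, h8⟩ := hrem p₁ q₁ hd
    have hlc : φ q₁.leadingCoeff ≠ 0 := h6.resolve_left (by rintro rfl; simp at hd)
    refine ⟨_, ⟨rem p₁ q₁, hremD p₁ hp₁ q₁ hq₁ hd hle, rfl⟩, ?_, ?_, ?_⟩
    · rw [(hdeg q₁ hq₁ h6).1]
      exact Polynomial.natDegree_map_le.trans_lt h7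
    · intro y hy
      have h9 := congrArg (fun u => (u.map φ).eval y) h8
      rw [Polynomial.map_mul, Polynomial.map_C, Polynomial.map_add, Polynomial.map_mul,
        Polynomial.eval_mul, Polynomial.eval_add, Polynomial.eval_mul, Polynomial.eval_C, hy,
        zero_mul, zero_add, map_pow, map_pow] at h9
      rw [← h9, sign_mul, sign_pos (by positivity), one_mul]
    · intro y hy
      have h9 := congrArg (fun u => (u.map φ').eval y) h8
      rw [Polynomial.map_mul, Polynomial.map_C, Polynomial.map_add, Polynomial.map_mul,
        Polynomial.eval_mul, Polynomial.eval_add, Polynomial.eval_mul, Polynomial.eval_C, hy,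
        zero_mul, zero_add, map_pow, map_pow] at h9
      have := hne q₁ hq₁ hlc
      rw [← h9, sign_mul, sign_pos (by positivity), one_mul]

/-- Elimination of one variable: the sign conditions of finitely many polynomials that are
realized over a point depend only on the signs of finitely many coefficients. -/
lemma exists_finset_forall_exists_sign_eq.{u, v} (P : Finset (Polynomial B)) :
    ∃ Q : Finset B, ∀ (R : Type u) (R' : Type v) [Field R] [LinearOrder R]
      [IsStrictOrderedRing R] [Field R'] [LinearOrder R'] [IsStrictOrderedRing R'],
      PolyIVT R → PolyIVT R' → ∀ (φ : B →+* R) (φ' : B →+* R'),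
      (∀ b ∈ Q, SignType.sign (φ b) = SignType.sign (φ' b)) →
      ∀ y : R, ∃ y' : R', ∀ p ∈ P,
        SignType.sign ((p.map φ).eval y) = SignType.sign ((p.map φ').eval y') := by
  classical
  choose! rem hrem using fun p (q : Polynomial B) (hq : 0 < q.natDegree) =>
    exists_even_pow_mul_eq_add q hq p
  obtain ⟨D, hPD, hD⟩ := exists_finset_closed (X := Polynomial B) Polynomial.natDegree
    (fun p q => {rem p q, q.derivative, q.eraseLead}) (by
      intro p q hq _ r hr
      simp only [Finset.mem_insert, Finset.mem_singleton] at hr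
      rcases hr with rfl | rfl | rfl
      · exact (hrem p q hq).1
      · exact Polynomial.natDegree_derivative_lt hq.ne'
      · exact (Polynomial.eraseLead_natDegree_le q).trans_lt (by omega)) (insert 0 P)
  refine ⟨D.image Polynomial.leadingCoeff, ?_⟩
  intro R R' _ _ _ _ _ _ hR hR' φ φ' h y
  have hG := goodFamily_image (R := R) (R' := R') hrem (hPD (Finset.mem_insert_self _ _))
    (fun p hp hd => hD p hp p hp hd le_rfl (by simp))
    (fun p hp hd => hD p hp p hp hd le_rfl (by simp))
    (fun p hp q hq hd hle => hD p hp q hq hd hle (by simp)) (φ := φ) (φ' := φ')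
    (fun p hp => h _ (Finset.mem_image_of_mem _ hp))
  rw [← Finset.coe_image] at hG
  obtain ⟨y', hy'⟩ := hG.exists_sign_eq hR hR' _ y
  exact ⟨y', fun p hp => hy' _ (Finset.mem_image_of_mem _ (hPD (Finset.mem_insert_of_mem hp)))⟩

end Lifting

section Transfer

lemma polyIVT_real : PolyIVT ℝ := by
  intro p a b hab h
  have hc : ContinuousOn (fun x => p.eval x) (Set.Icc a b) := p.continuous.continuousOn
  rcases lt_or_ge (p.eval a) 0 with ha | ha
  · have hb : 0 < p.eval b := by
      by_contra hb
      exact absurd h (not_lt.2 (mul_nonneg_of_nonpos_of_nonpos ha.le (not_lt.1 hb)))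
    obtain ⟨c, hc1, hc2⟩ := intermediate_value_Ioo hab.le hc ⟨ha, hb⟩
    exact ⟨c, hc1.1, hc1.2, hc2⟩
  · have ha' : 0 < p.eval a := lt_of_le_of_ne ha (by rintro h0; rw [← h0] at h; simp at h)
    have hb : p.eval b < 0 := by
      by_contra hb
      exact absurd h (not_lt.2 (mul_nonneg ha (not_lt.1 hb)))
    obtain ⟨c, hc1, hc2⟩ := intermediate_value_Ioo' hab.le hc ⟨hb, ha'⟩
    exact ⟨c, hc1.1, hc1.2, hc2⟩

variable {R : Type*} [Field R] [LinearOrder R] [IsStrictOrderedRing R]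

lemma sign_ringHom_real (φ : ℝ →+* R) (c : ℝ) : SignType.sign (φ c) = SignType.sign c := by
  have hpos : ∀ c : ℝ, 0 < c → 0 < φ c := fun c hc => by
    have h : c = √c ^ 2 := (Real.sq_sqrt hc.le).symm
    rw [h, map_pow]
    have : φ √c ≠ 0 := (map_ne_zero φ).2 (Real.sqrt_pos.2 hc).ne'
    positivity
  rcases lt_trichotomy c 0 with h | rfl | h
  · have := hpos (-c) (neg_pos.2 h)
    rw [map_neg, neg_pos] at this
    rw [sign_neg h, sign_neg this]
  · simp
  · rw [sign_pos h, sign_pos (hpos c h)]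

lemma exists_real_sign_eq_fin (hR : PolyIVT R) (φ : ℝ →+* R) (k : ℕ)
    (P : Finset (MvPolynomial (Fin k) ℝ)) (ξ : Fin k → R) :
    ∃ x : Fin k → ℝ, ∀ p ∈ P,
      SignType.sign (eval₂ φ ξ p) = SignType.sign (eval x p) := by
  classical
  induction k with
  | zero =>
    refine ⟨fun i => i.elim0, fun p _ => ?_⟩
    rw [MvPolynomial.eq_C_of_isEmpty p, eval₂_C, eval_C, sign_ringHom_real]
  | succ k ih =>
    obtain ⟨Q, hQ⟩ := exists_finset_forall_exists_sign_eq (P.image (finSuccEquiv ℝ k))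
    obtain ⟨x, hx⟩ := ih Q (fun i => ξ i.succ)
    obtain ⟨y, hy⟩ := hQ R ℝ hR polyIVT_real (eval₂Hom φ fun i : Fin k => ξ i.succ) (eval x)
      (fun b hb => hx b hb) (ξ 0)
    refine ⟨Fin.cons y x, fun p hp => ?_⟩
    have := hy _ (Finset.mem_image_of_mem _ hp)
    rw [eval_eq_eval_mv_eval', ← this]
    congr 1
    have hring : (eval₂Hom φ ξ) = ((Polynomial.evalRingHom (ξ 0)).comp
        (Polynomial.mapRingHom (eval₂Hom φ fun i : Fin k => ξ i.succ))).comp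
        (finSuccEquiv ℝ k : MvPolynomial (Fin (k + 1)) ℝ →+* _) := by
      refine MvPolynomial.ringHom_ext (fun c => ?_) (fun i => ?_)
      · simp [finSuccEquiv_apply]
      · refine Fin.cases ?_ (fun i => ?_) i
        · simp [finSuccEquiv_X_zero]
        · simp [finSuccEquiv_X_succ]
    exact congrArg (fun h : MvPolynomial (Fin (k + 1)) ℝ →+* R => h p) hring

/-- Transfer of finitely many sign conditions from an ordered extension field with the
intermediate value property to the real numbers. -/
lemma exists_real_sign_eq (hR : PolyIVT R) (φ : ℝ →+* R) {τ : Type*} [Finite τ]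
    (P : Finset (MvPolynomial τ ℝ)) (ξ : τ → R) :
    ∃ x : τ → ℝ, ∀ p ∈ P, SignType.sign (eval₂ φ ξ p) = SignType.sign (eval x p) := by
  classical
  obtain ⟨k, ⟨e⟩⟩ := Finite.exists_equiv_fin τ
  obtain ⟨x, hx⟩ := exists_real_sign_eq_fin hR φ k (P.image (rename e)) (ξ ∘ e.symm)
  refine ⟨x ∘ e, fun p hp => ?_⟩
  have := hx _ (Finset.mem_image_of_mem _ hp)
  rw [eval₂_rename, eval_rename] at this
  simpa [Function.comp_assoc] using this

end Transfer

lemma exists_linearOrder_of_isSquare {F : Type*} [Field F]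
    (hsq : ∀ a : F, IsSquare a ∨ IsSquare (-a))
    (hadd : ∀ a b : F, IsSquare a → IsSquare b → IsSquare (a + b)) (hneg : ¬ IsSquare (-1 : F)) :
    ∃ (_ : LinearOrder F) (_ : IsStrictOrderedRing F), ∀ a : F, 0 ≤ a ↔ IsSquare a := by
  classical
  let P : RingCone F :=
    { carrier := {a | IsSquare a}
      mul_mem' := fun ha hb => IsSquare.mul ha hb
      one_mem' := IsSquare.one
      add_mem' := fun {a b} ha hb => hadd a b ha hb
      zero_mem' := IsSquare.zero
      eq_zero_of_mem_of_neg_mem' := by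
        intro a ha hb
        by_contra h0
        apply hneg
        have : (-1 : F) = (-a) / a := by field_simp
        rw [this]
        exact IsSquare.div hb ha }
  have hP : ∀ a, a ∈ P ↔ IsSquare a := fun a => Iff.rfl
  have : HasMemOrNegMem P := ⟨fun a => hsq a⟩
  let l : LinearOrder F := LinearOrder.mkOfAddGroupCone P
  have ho : IsOrderedRing F := IsOrderedRing.mkOfCone P
  refine ⟨l, IsOrderedRing.toIsStrictOrderedRing F, fun a => ?_⟩
  rw [← hP]
  change a - 0 ∈ P ↔ a ∈ P
  rw [sub_zero]

section RealClosure

variable {Ω : Type*} [Field Ω] (T : Subsemiring Ω)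

/-- The sums of elements `t * y ^ 2` with `t ∈ T` and `y ∈ F`. -/
def weightedCone (F : Subfield Ω) : Subsemiring Ω :=
  Submonoid.subsemiringClosure
    { carrier := {z | ∃ t ∈ T, ∃ y ∈ F, z = t * y ^ 2}
      mul_mem' := by
        rintro _ _ ⟨t, ht, y, hy, rfl⟩ ⟨s, hs, z, hz, rfl⟩
        exact ⟨t * s, mul_mem ht hs, y * z, mul_mem hy hz, by ring⟩
      one_mem' := ⟨1, one_mem _, 1, one_mem _, by simp⟩ }

variable {T} {F : Subfield Ω}

lemma mem_weightedCone {z : Ω} : z ∈ weightedCone T F ↔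
    z ∈ AddSubmonoid.closure {z | ∃ t ∈ T, ∃ y ∈ F, z = t * y ^ 2} :=
  Submonoid.subsemiringClosure_mem _

lemma mul_sq_mem_weightedCone {t y : Ω} (ht : t ∈ T) (hy : y ∈ F) :
    t * y ^ 2 ∈ weightedCone T F :=
  mem_weightedCone.2 (AddSubmonoid.subset_closure ⟨t, ht, y, hy, rfl⟩)

lemma mem_weightedCone_of_mem {t : Ω} (ht : t ∈ T) : t ∈ weightedCone T F := by
  simpa using mul_sq_mem_weightedCone ht (one_mem F)

lemma sq_mem_weightedCone {y : Ω} (hy : y ∈ F) : y ^ 2 ∈ weightedCone T F := by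
  simpa using mul_sq_mem_weightedCone (one_mem T) hy

lemma weightedCone_induction {p : ∀ z, z ∈ weightedCone T F → Prop}
    (mem : ∀ t (ht : t ∈ T) y (hy : y ∈ F), p (t * y ^ 2) (mul_sq_mem_weightedCone ht hy))
    (zero : p 0 (zero_mem _))
    (add : ∀ x y hx hy, p x hx → p y hy → p (x + y) (add_mem hx hy)) {z : Ω}
    (hz : z ∈ weightedCone T F) : p z hz := by
  have hz' := mem_weightedCone.1 hz
  suffices h : ∃ h, p z h from h.2
  clear hz
  induction hz' using AddSubmonoid.closure_induction with
  | mem z h =>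
    obtain ⟨t, ht, y, hy, rfl⟩ := h
    exact ⟨_, mem t ht y hy⟩
  | zero => exact ⟨_, zero⟩
  | add x y _ _ h1 h2 => exact ⟨_, add x y _ _ h1.2 h2.2⟩

lemma exists_maximal_subfield (F₀ : Subfield Ω) (hT : (T : Set Ω) ⊆ F₀)
    (h0 : (-1 : Ω) ∉ weightedCone T F₀) :
    ∃ F, F₀ ≤ F ∧ Maximal (fun F : Subfield Ω => (T : Set Ω) ⊆ F ∧ (-1 : Ω) ∉ weightedCone T F)
      F := by
  refine zorn_le_nonempty₀ {F : Subfield Ω | (T : Set Ω) ⊆ F ∧ (-1 : Ω) ∉ weightedCone T F}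
    (fun c hc hchain F hF => ?_) F₀ ⟨hT, h0⟩
  have hmem : ∀ {x : Ω}, x ∈ sSup c ↔ ∃ s ∈ c, x ∈ s :=
    Subfield.mem_sSup_of_directedOn ⟨F, hF⟩ hchain.directedOn
  refine ⟨sSup c, ⟨(hc hF).1.trans (fun x hx => hmem.2 ⟨F, hF, hx⟩), fun hneg => ?_⟩,
    fun _ h => le_sSup h⟩
  have key : ∀ z ∈ weightedCone T (sSup c), ∃ s ∈ c, z ∈ weightedCone T s := by
    intro z hz
    induction hz using weightedCone_induction with
    | mem t ht y hy =>
      obtain ⟨s, hs, hys⟩ := hmem.1 hy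
      exact ⟨s, hs, mul_sq_mem_weightedCone ht hys⟩
    | zero => exact ⟨F, hF, zero_mem _⟩
    | add x y _ _ h1 h2 =>
      obtain ⟨s, hs, h3⟩ := h1
      obtain ⟨t, ht, h4⟩ := h2
      obtain ⟨u, hu, hsu, htu⟩ := hchain.directedOn s hs t ht
      have hmono : ∀ {s : Subfield Ω}, s ≤ u → ∀ z ∈ weightedCone T s, z ∈ weightedCone T u := by
        intro s hsu z hz
        rw [mem_weightedCone] at hz ⊢
        refine AddSubmonoid.closure_mono ?_ hz
        rintro _ ⟨t, ht, y, hy, rfl⟩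
        exact ⟨t, ht, y, hsu hy, rfl⟩
      exact ⟨u, hu, add_mem (hmono hsu x h3) (hmono htu y h4)⟩
  obtain ⟨s, hs, h⟩ := key _ hneg
  exact (hc hs).2 h

variable [IsAlgClosed Ω]

lemma exists_dvd_one_add
    (hF : Maximal (fun F : Subfield Ω => (T : Set Ω) ⊆ F ∧ (-1 : Ω) ∉ weightedCone T F) F)
    {p : Polynomial F} (hp : Irreducible p) (h2 : 2 ≤ p.natDegree) :
    ∃ h ∈ AddSubmonoid.closure {h : Polynomial F | ∃ (t : F) (f : Polynomial F), (t : Ω) ∈ T ∧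
      f.natDegree < p.natDegree ∧ h = Polynomial.C t * f ^ 2}, p ∣ 1 + h := by
  have : Fact (Irreducible p) := ⟨hp⟩
  have hdeg : p.degree ≠ 0 := by
    intro h
    have := Polynomial.natDegree_eq_zero_iff_degree_le_zero.2 h.le
    omega
  obtain ⟨α, hα⟩ := IsAlgClosed.exists_eval₂_eq_zero F.subtype p hdeg
  set L : AdjoinRoot p →+* Ω := AdjoinRoot.lift F.subtype α hα with hL
  have hLF : F ≤ L.fieldRange := fun x hx => ⟨AdjoinRoot.of p ⟨x, hx⟩, by simp [hL]⟩
  have hαL : α ∈ L.fieldRange := ⟨AdjoinRoot.root p, by simp [hL]⟩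
  have hαF : α ∉ F := by
    intro h
    have hroot : p.IsRoot ⟨α, h⟩ := by
      apply F.subtype.injective
      rw [map_zero, ← hα]
      exact (Polynomial.eval₂_at_apply F.subtype ⟨α, h⟩).symm
    have : p.natDegree = 1 := Polynomial.natDegree_eq_of_degree_eq_some
      (Polynomial.degree_eq_one_of_irreducible_of_root hp hroot)
    omega
  have hneg : (-1 : Ω) ∈ weightedCone T L.fieldRange := by
    by_contra h
    exact hαF (hF.2 ⟨hF.1.1.trans hLF, h⟩ hLF hαL)
  have key : ∀ z ∈ weightedCone T L.fieldRange, ∃ h ∈ AddSubmonoid.closure {h : Polynomial F |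
      ∃ (t : F) (f : Polynomial F), (t : Ω) ∈ T ∧ f.natDegree < p.natDegree ∧
        h = Polynomial.C t * f ^ 2}, L (AdjoinRoot.mk p h) = z := by
    intro z hz
    induction hz using weightedCone_induction with
    | mem t ht _ hy =>
      obtain ⟨y, rfl⟩ := hy
      obtain ⟨f, rfl⟩ := AdjoinRoot.mk_surjective y
      have hmod : AdjoinRoot.mk p f = AdjoinRoot.mk p (f % p) := by
        rw [AdjoinRoot.mk_eq_mk]
        exact ⟨f / p, by rw [sub_eq_iff_eq_add, EuclideanDomain.div_add_mod]⟩
      refine ⟨_, AddSubmonoid.subset_closure ⟨⟨t, hF.1.1 ht⟩, f % p, ht,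
        Polynomial.natDegree_mod_lt f (by omega), rfl⟩, ?_⟩
      rw [hmod, map_mul, map_mul, map_pow, map_pow]
      congr 1
      simp [hL]
    | zero => exact ⟨0, zero_mem _, by simp⟩
    | add x y _ _ h1 h2 =>
      obtain ⟨h, hh, rfl⟩ := h1
      obtain ⟨h', hh', rfl⟩ := h2
      exact ⟨h + h', add_mem hh hh', by simp⟩
  obtain ⟨h, hh, hz⟩ := key _ hneg
  refine ⟨h, hh, ?_⟩
  rw [← AdjoinRoot.mk_eq_zero]
  apply L.injective
  rw [map_add, map_add, hz]
  simp

lemma neg_mem_weightedCone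
    (hF : Maximal (fun F : Subfield Ω => (T : Set Ω) ⊆ F ∧ (-1 : Ω) ∉ weightedCone T F) F)
    {a : F} (ha : ¬ IsSquare a) : -(a : Ω) ∈ weightedCone T F := by
  have hirr : Irreducible (Polynomial.X ^ 2 - Polynomial.C a : Polynomial F) :=
    X_pow_sub_C_irreducible_of_prime Nat.prime_two
      fun b hb => ha ⟨b, by rw [← hb, sq]⟩
  have hdeg : (Polynomial.X ^ 2 - Polynomial.C a : Polynomial F).natDegree = 2 :=
    Polynomial.natDegree_X_pow_sub_C
  obtain ⟨h, hh, hdvd⟩ := exists_dvd_one_add hF hirr hdeg.ge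
  have key : ∃ c d v : F, (c : Ω) ∈ weightedCone T F ∧ (d : Ω) ∈ weightedCone T F ∧
      (Polynomial.X ^ 2 - Polynomial.C a) ∣
        h - (Polynomial.C (c + a * d) + Polynomial.C v * Polynomial.X) := by
    clear hdvd
    induction hh using AddSubmonoid.closure_induction with
    | mem h hh =>
      obtain ⟨t, f, ht, hf, rfl⟩ := hh
      rw [hdeg] at hf
      obtain ⟨u, w, rfl⟩ := Polynomial.exists_eq_X_add_C_of_natDegree_le_one
        (Nat.le_of_lt_succ hf)
      refine ⟨t * w ^ 2, t * u ^ 2, 2 * t * u * w, mul_sq_mem_weightedCone ht w.2,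
        mul_sq_mem_weightedCone ht u.2, Polynomial.C (t * u ^ 2), ?_⟩
      simp only [Polynomial.C_add, Polynomial.C_mul, Polynomial.C_pow]
      have : (Polynomial.C (2 : F)) = 2 := rfl
      rw [this]
      ring
    | zero => exact ⟨0, 0, 0, zero_mem _, zero_mem _, by simp⟩
    | add x y hx hy h1 h2 =>
      obtain ⟨c, d, v, hc, hd, e, he⟩ := h1
      obtain ⟨c', d', v', hc', hd', e', he'⟩ := h2
      refine ⟨c + c', d + d', v + v', add_mem hc hc', add_mem hd hd', e + e', ?_⟩
      simp only [Polynomial.C_add, Polynomial.C_mul] at he he' ⊢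
      linear_combination he + he'
  obtain ⟨c, d, v, hc, hd, hdvd'⟩ := key
  have h3 : (Polynomial.X ^ 2 - Polynomial.C a) ∣
      Polynomial.C v * Polynomial.X + Polynomial.C (1 + (c + a * d)) := by
    have := dvd_sub hdvd hdvd'
    convert this using 1
    simp only [Polynomial.C_add, Polynomial.C_1]
    ring
  have h4 : Polynomial.C v * Polynomial.X + Polynomial.C (1 + (c + a * d)) = 0 := by
    refine Polynomial.eq_zero_of_dvd_of_natDegree_lt h3 ?_
    rw [hdeg]
    exact Nat.lt_succ_of_le (Polynomial.natDegree_linear_le)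
  have h5 : 1 + (c + a * d) = 0 := by
    have := congrArg (fun q => Polynomial.coeff q 0) h4
    simpa using this
  have h6 : (1 : Ω) + (c + a * d) = 0 := by exact_mod_cast congrArg (Subtype.val) h5
  have hd0 : (d : Ω) ≠ 0 := by
    intro h
    rw [h, mul_zero, add_zero] at h6
    exact hF.1.2 (by rwa [← eq_neg_of_add_eq_zero_right h6])
  have h7 : -(a : Ω) = (1 + c) * d * (d⁻¹ : Ω) ^ 2 := by
    field_simp
    linear_combination -h6
  rw [h7]
  exact mul_mem (mul_mem (add_mem (one_mem _) hc) hd) (sq_mem_weightedCone (inv_mem d.2))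

lemma isSquare_of_mem_weightedCone
    (hF : Maximal (fun F : Subfield Ω => (T : Set Ω) ⊆ F ∧ (-1 : Ω) ∉ weightedCone T F) F)
    {a : F} (ha : (a : Ω) ∈ weightedCone T F) : IsSquare a := by
  by_contra h
  have h1 := neg_mem_weightedCone hF h
  have h0 : (a : Ω) ≠ 0 := by
    intro h0
    have : a = 0 := Subtype.ext h0
    exact h (this ▸ IsSquare.zero)
  refine hF.1.2 ?_
  have h2 : (-1 : Ω) = a * -a * (a⁻¹ : Ω) ^ 2 := by field_simp
  rw [h2]
  exact mul_mem (mul_mem ha h1) (sq_mem_weightedCone (inv_mem a.2))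

lemma exists_irreducible_sign_change {F : Type*} [Field F] [LinearOrder F] [IsStrictOrderedRing F]
    (p : Polynomial F) {a b : F} (h : p.eval a * p.eval b < 0) :
    ∃ r, Irreducible r ∧ r ∣ p ∧ r.eval a * r.eval b < 0 := by
  induction p using WfDvdMonoid.induction_on_irreducible with
  | zero => simp at h
  | unit u hu =>
    obtain ⟨c, -, rfl⟩ := Polynomial.isUnit_iff.1 hu
    simp only [Polynomial.eval_C] at h
    exact absurd h (not_lt.2 (mul_self_nonneg c))
  | mul p i hp hi ih =>
    by_cases hs : i.eval a * i.eval b < 0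
    · exact ⟨i, hi, dvd_mul_right _ _, hs⟩
    · obtain ⟨r, hr, hrp, hrs⟩ := ih (by
        by_contra hs'
        apply absurd h (not_lt.2 _)
        rw [Polynomial.eval_mul, Polynomial.eval_mul, mul_mul_mul_comm]
        exact mul_nonneg (not_lt.1 hs) (not_lt.1 hs'))
      exact ⟨r, hr, hrp.mul_left _, hrs⟩

/-- A subring of an algebraically closed field on which a cone containing the squares does not
contain `-1` embeds in an ordered field with the intermediate value property. -/
theorem exists_ordered_subfield (F₀ : Subfield Ω) (hT : (T : Set Ω) ⊆ F₀)
    (h0 : (-1 : Ω) ∉ weightedCone T F₀) :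
    ∃ (F : Subfield Ω) (_ : LinearOrder F) (_ : IsStrictOrderedRing F), F₀ ≤ F ∧
      (∀ x : F, (x : Ω) ∈ T → 0 ≤ x) ∧ PolyIVT F := by
  obtain ⟨F, hF₀, hF⟩ := exists_maximal_subfield F₀ hT h0
  obtain ⟨l, ho, hl⟩ := exists_linearOrder_of_isSquare (F := F)
    (fun a => by
      by_contra! h
      exact h.2 (isSquare_of_mem_weightedCone hF (neg_mem_weightedCone hF h.1)))
    (fun a b ha hb => by
      obtain ⟨a, rfl⟩ := ha
      obtain ⟨b, rfl⟩ := hb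
      refine isSquare_of_mem_weightedCone hF ?_
      rw [← sq, ← sq]
      exact add_mem (sq_mem_weightedCone a.2) (sq_mem_weightedCone b.2))
    (by
      rintro ⟨a, ha⟩
      refine hF.1.2 ?_
      have h1 : (-1 : Ω) = (a : Ω) ^ 2 := by
        rw [sq]
        exact congrArg Subtype.val ha
      rw [h1]
      exact sq_mem_weightedCone a.2)
  have hTF : ∀ x : F, (x : Ω) ∈ T → 0 ≤ x := fun x hx =>
    (hl x).2 (isSquare_of_mem_weightedCone hF (mem_weightedCone_of_mem hx))
  refine ⟨F, l, ho, hF₀, hTF, ?_⟩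
  intro p a b hab hp
  induction hn : p.natDegree using Nat.strong_induction_on generalizing p with
  | _ n ih =>
    subst hn
    obtain ⟨r, hr, hrp, hrs⟩ := exists_irreducible_sign_change p hp
    have hp0 : p ≠ 0 := by rintro rfl; simp at hp
    have hle := Polynomial.natDegree_le_of_dvd hrp hp0
    suffices h : ∃ c, a < c ∧ c < b ∧ r.eval c = 0 by
      obtain ⟨c, h1, h2, h3⟩ := h
      obtain ⟨s, rfl⟩ := hrp
      exact ⟨c, h1, h2, by simp [h3]⟩
    rcases lt_or_ge r.natDegree 2 with h2 | h2
    · obtain ⟨u, v, rfl⟩ := Polynomial.exists_eq_X_add_C_of_natDegree_le_one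
        (Nat.le_of_lt_succ h2)
      simp only [Polynomial.eval_add, Polynomial.eval_mul, Polynomial.eval_C,
        Polynomial.eval_X] at hrs ⊢
      have hu : u ≠ 0 := by
        rintro rfl
        nlinarith [mul_self_nonneg v]
      have h3 : (a - -v / u) * (b - -v / u) < 0 := by
        have h4 : (u * a + v) * (u * b + v) = u ^ 2 * ((a - -v / u) * (b - -v / u)) := by
          field_simp
          ring
        rw [h4] at hrs
        by_contra h5
        exact absurd hrs (not_lt.2 (mul_nonneg (sq_nonneg u) (not_lt.1 h5)))
      refine ⟨-v / u, ?_, ?_, by field_simp; ring⟩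
      · by_contra h
        nlinarith [not_lt.1 h]
      · by_contra h
        nlinarith [not_lt.1 h]
    · obtain ⟨h, hh, q, hq⟩ := exists_dvd_one_add hF hr h2
      have hnn : ∀ c, 0 ≤ h.eval c := by
        intro c
        clear hq
        induction hh using AddSubmonoid.closure_induction with
        | mem h hh =>
          obtain ⟨t, f, ht, -, rfl⟩ := hh
          have := hTF t ht
          simp only [Polynomial.eval_mul, Polynomial.eval_C, Polynomial.eval_pow]
          positivity
        | zero => simp
        | add x y hx hy h1 h2 =>
          rw [Polynomial.eval_add]
          exact add_nonneg h1 h2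
      have hdeg : h.natDegree ≤ 2 * (r.natDegree - 1) := by
        clear hq hnn
        induction hh using AddSubmonoid.closure_induction with
        | mem h hh =>
          obtain ⟨t, f, -, hf, rfl⟩ := hh
          refine (Polynomial.natDegree_C_mul_le _ _).trans (Polynomial.natDegree_pow_le.trans ?_)
          gcongr
          omega
        | zero => simp
        | add x y hx hy h1 h2 => exact (Polynomial.natDegree_add_le _ _).trans (max_le h1 h2)
      have hpos : ∀ c, 0 < r.eval c * q.eval c := by
        intro c
        rw [← Polynomial.eval_mul, ← hq, Polynomial.eval_add, Polynomial.eval_one]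
        have := hnn c
        linarith
      have hq0 : q ≠ 0 := by
        rintro rfl
        simpa using hpos a
      have hqdeg : q.natDegree < r.natDegree := by
        have h3 := congrArg Polynomial.natDegree hq
        rw [Polynomial.natDegree_mul hr.ne_zero hq0] at h3
        have h4 := Polynomial.natDegree_add_le 1 h
        rw [Polynomial.natDegree_one] at h4
        omega
      obtain ⟨c, -, -, hc⟩ := ih q.natDegree (hqdeg.trans_le hle) q (by
        by_contra h3
        have h4 := mul_pos (hpos a) (hpos b)
        rw [mul_mul_mul_comm] at h4
        exact absurd h4 (not_lt.2 (mul_nonpos_of_nonpos_of_nonneg hrs.le (not_lt.1 h3)))) rfl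
      have := hpos c
      rw [hc, mul_zero] at this
      exact absurd this (lt_irrefl _)

end RealClosure

universe u

section Positivstellensatz

variable {A : Type u} [CommRing A] (T : Subsemiring A)

/-- A semiring `T` of a ring containing the squares and not `-1` is contained in a cone with
prime support. -/
lemma exists_isPrime_sq_add_notMem (hsq : ∀ a, a ^ 2 ∈ T) (hneg : -1 ∉ T) :
    ∃ p : Ideal A, p.IsPrime ∧ ∀ b ∉ p, ∀ t ∈ T, b ^ 2 + t ∉ p := by
  let S : Submonoid A :=
    { carrier := {s | ∃ t ∈ T, s = 1 + t}
      one_mem' := ⟨0, zero_mem _, by simp⟩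
      mul_mem' := by
        rintro _ _ ⟨t, ht, rfl⟩ ⟨s, hs, rfl⟩
        exact ⟨s + t + t * s, add_mem (add_mem hs ht) (mul_mem ht hs), by ring⟩ }
  have hS : Disjoint ((⊥ : Ideal A) : Set A) S := by
    rw [Set.disjoint_left]
    rintro x hx ⟨t, ht, rfl⟩
    apply hneg
    rwa [neg_eq_of_add_eq_zero_right (Ideal.mem_bot.1 hx)]
  obtain ⟨p, -, hp⟩ := zorn_le_nonempty₀ {p : Ideal A | Disjoint (p : Set A) S}
    (fun c hc hchain x hx => by
      refine ⟨sSup c, ?_, fun _ h => le_sSup h⟩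
      rw [Set.mem_ofPred_eq, Set.disjoint_left]
      intro y hy hyS
      obtain ⟨I, hI, hyI⟩ := (Submodule.mem_sSup_of_directed ⟨x, hx⟩ hchain.directedOn).1 hy
      exact Set.disjoint_left.1 (hc hI) hyI hyS) ⊥ hS
  refine ⟨p, Ideal.isPrime_of_maximally_disjoint p S hp.1 fun J hJ hd => ?_, ?_⟩
  · exact hJ.not_ge (hp.2 hd hJ.le)
  · intro b hb t ht hbt
    have h : ¬ Disjoint ((p ⊔ Ideal.span {b} : Ideal A) : Set A) S := fun hd =>
      hb (hp.2 hd le_sup_left (Ideal.mem_sup_right (Ideal.mem_span_singleton_self b)))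
    rw [Set.not_disjoint_iff] at h
    obtain ⟨_, h1, u, hu, rfl⟩ := h
    obtain ⟨x, hx, y, hy, hxy⟩ := Submodule.mem_sup.1 h1
    obtain ⟨r, rfl⟩ := Ideal.mem_span_singleton'.1 hy
    have hpS : Disjoint (p : Set A) S := hp.1
    refine Set.disjoint_left.1 hpS (?_ : (1 + u) ^ 2 + t * r ^ 2 ∈ p)
      ⟨u + u + u ^ 2 + t * r ^ 2, add_mem (add_mem (add_mem hu hu) (hsq u))
        (mul_mem ht (hsq r)), by ring⟩
    have : (1 + u) ^ 2 + t * r ^ 2 = (x + 2 * r * b) * x + r ^ 2 * (b ^ 2 + t) := by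
      rw [← hxy]
      ring
    rw [this]
    exact add_mem (Ideal.mul_mem_left _ _ hx) (Ideal.mul_mem_left _ _ hbt)

theorem exists_ringHom_nonneg (hsq : ∀ a, a ^ 2 ∈ T) (hneg : -1 ∉ T) :
    ∃ (R : Type u) (_ : Field R) (_ : LinearOrder R) (_ : IsStrictOrderedRing R) (φ : A →+* R),
      PolyIVT R ∧ ∀ t ∈ T, 0 ≤ φ t := by
  obtain ⟨p, hp, h⟩ := exists_isPrime_sq_add_notMem T hsq hneg
  let K := FractionRing (A ⧸ p)
  let Ω := AlgebraicClosure K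
  let κ : A →+* K := (algebraMap (A ⧸ p) K).comp (Ideal.Quotient.mk p)
  let ι : A →+* Ω := (algebraMap K Ω).comp κ
  have hκ : ∀ a, κ a = 0 ↔ a ∈ p := by
    intro a
    rw [← Ideal.Quotient.eq_zero_iff_mem]
    exact map_eq_zero_iff _ (IsFractionRing.injective (A ⧸ p) K)
  have hι : ∀ a, ι a = 0 ↔ a ∈ p := fun a =>
    (map_eq_zero_iff _ (algebraMap K Ω).injective).trans (hκ a)
  have key : ∀ z ∈ weightedCone (T.map ι) (algebraMap K Ω).fieldRange,
      ∃ b ∉ p, ∃ t ∈ T, ι b ^ 2 * z = ι t := by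
    intro z hz
    induction hz using weightedCone_induction with
    | mem t ht y hy =>
      obtain ⟨t, ht, rfl⟩ := ht
      obtain ⟨y, rfl⟩ := hy
      obtain ⟨a, b, hb, rfl⟩ := IsFractionRing.div_surjective (A := A ⧸ p) y
      obtain ⟨a, rfl⟩ := Ideal.Quotient.mk_surjective a
      obtain ⟨b, rfl⟩ := Ideal.Quotient.mk_surjective b
      have hbp : b ∉ p := by
        rw [← Ideal.Quotient.eq_zero_iff_mem]
        exact nonZeroDivisors.ne_zero hb
      refine ⟨b, hbp, t * a ^ 2, mul_mem ht (hsq a), ?_⟩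
      have hb0 : ι b ≠ 0 := fun h => hbp ((hι b).1 h)
      rw [map_div₀]
      change ι b ^ 2 * (ι t * (ι a / ι b) ^ 2) = _
      rw [map_mul, map_pow, div_pow]
      rw [mul_left_comm, mul_div_cancel₀ _ (pow_ne_zero 2 hb0)]
    | zero => exact ⟨1, p.ne_top_iff_one.1 hp.ne_top, 0, zero_mem _, by simp⟩
    | add x y _ _ h1 h2 =>
      obtain ⟨b, hb, t, ht, h1⟩ := h1
      obtain ⟨c, hc, s, hs, h2⟩ := h2
      refine ⟨b * c, fun hbc => (hp.mem_or_mem hbc).elim hb hc, c ^ 2 * t + b ^ 2 * s,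
        add_mem (mul_mem (hsq c) ht) (mul_mem (hsq b) hs), ?_⟩
      simp only [map_add, map_mul, map_pow]
      linear_combination ι c ^ 2 * h1 + ι b ^ 2 * h2
  obtain ⟨F, l, ho, hF, hT, hR⟩ := exists_ordered_subfield (T := T.map ι)
    (algebraMap K Ω).fieldRange
    (by
      rintro _ ⟨t, -, rfl⟩
      exact ⟨κ t, rfl⟩)
    (by
      intro hmem
      obtain ⟨b, hb, t, ht, hbt⟩ := key _ hmem
      refine h b hb t ht ((hι _).1 ?_)
      rw [map_add, map_pow, ← hbt]
      ring)
  refine ⟨F, inferInstance, l, ho, ι.codRestrict F fun a => hF ⟨κ a, rfl⟩, hR, fun t ht => ?_⟩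
  exact hT _ (Subsemiring.mem_map.2 ⟨t, ht, rfl⟩)

/-- A form of the Krivine-Stengle Positivstellensatz. -/
theorem exists_forall_eval_nonneg {τ : Type*} [Finite τ] (T : Subsemiring (MvPolynomial τ ℝ))
    (hsq : ∀ a, a ^ 2 ∈ T) (hneg : -1 ∉ T) {G : Set (MvPolynomial τ ℝ)} (hG : G.Finite)
    (hGT : G ⊆ T) : ∃ x : τ → ℝ, ∀ p ∈ G, 0 ≤ eval x p := by
  obtain ⟨R, _, _, _, φ, hR, hφ⟩ := exists_ringHom_nonneg T hsq hneg
  obtain ⟨x, hx⟩ := exists_real_sign_eq hR (φ.comp C) hG.toFinset fun i => φ (X i)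
  refine ⟨x, fun p hp => ?_⟩
  have h := hx p (hG.mem_toFinset.2 hp)
  have h1 : eval₂ (φ.comp C) (fun i => φ (X i)) p = φ p := by
    have := eval₂_comp_left φ (C : ℝ →+* MvPolynomial τ ℝ) X p
    rw [eval₂_eta] at this
    exact this.symm
  rw [h1] at h
  rw [← sign_nonneg_iff, ← h, sign_nonneg_iff]
  exact hφ p (hGT hp)

end Positivstellensatz

lemma isAlgebraic_of_kaehlerDifferential_D_eq_zero {k K : Type*} [Field k] [Field K] [CharZero k]
    [Algebra k K] [Algebra.EssFiniteType k K] {x : K} (hx : KaehlerDifferential.D k K x = 0) :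
    IsAlgebraic k x := by
  by_contra htr
  let _ : Algebra (Polynomial k) K := (Polynomial.aeval x).toAlgebra
  have halg : ∀ p : Polynomial k, algebraMap (Polynomial k) K p = Polynomial.aeval x p :=
    fun p => rfl
  have : IsScalarTower k (Polynomial k) K := IsScalarTower.of_algebraMap_eq fun r => by
    simp [halg]
  have : FaithfulSMul (Polynomial k) K := by
    rw [faithfulSMul_iff_algebraMap_injective]
    exact transcendental_iff_injective.1 htr
  let E := FractionRing (Polynomial k)
  let _ : Algebra E K := FractionRing.liftAlgebra _ _
  have : IsScalarTower (Polynomial k) E K := FractionRing.isScalarTower_liftAlgebra _ _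
  have : IsScalarTower k E K := IsScalarTower.of_algebraMap_eq fun r => by
    rw [IsScalarTower.algebraMap_apply k (Polynomial k) K,
      IsScalarTower.algebraMap_apply (Polynomial k) E K,
      IsScalarTower.algebraMap_apply k (Polynomial k) E]
  have : Algebra.EssFiniteType E K := Algebra.EssFiniteType.of_comp k E K
  have : CharZero E := charZero_of_injective_algebraMap (algebraMap k E).injective
  have : Algebra.FormallySmooth E K := inferInstance
  have : Algebra.FormallySmooth (Polynomial k) E :=
    .of_isLocalization (nonZeroDivisors (Polynomial k))
  have : Algebra.FormallySmooth (Polynomial k) K := .comp _ E _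
  have : Subsingleton (Algebra.H1Cotangent (Polynomial k) K) :=
    Algebra.FormallySmooth.subsingleton_h1Cotangent
  have h0 : (1 : K) ⊗ₜ[Polynomial k] KaehlerDifferential.D k (Polynomial k) Polynomial.X = 0 := by
    obtain ⟨y, hy⟩ := (Algebra.H1Cotangent.exact_δ_mapBaseChange k (Polynomial k) K _).1
      (show KaehlerDifferential.mapBaseChange k (Polynomial k) K
        ((1 : K) ⊗ₜ KaehlerDifferential.D k (Polynomial k) Polynomial.X) = 0 by
          rw [KaehlerDifferential.mapBaseChange_tmul, KaehlerDifferential.map_D, halg,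
            Polynomial.aeval_X, hx, smul_zero])
    rw [← hy, Subsingleton.elim y 0, map_zero]
  have h1 := congrArg (LinearMap.lTensor K (KaehlerDifferential.polynomialEquiv k).toLinearMap) h0
  have h2 := congrArg (TensorProduct.rid (Polynomial k) K) h1
  simp at h2

section FritzJohn

open KaehlerDifferential in
lemma kaehlerDifferential_D_aeval {n : ℕ} {K : Type*} [Field K] [Algebra ℝ K] (ξ : Fin n → K)
    (p : MvPolynomial (Fin n) ℝ) :
    D ℝ K (aeval ξ p) = ∑ i, aeval ξ (pderiv i p) • D ℝ K (ξ i) := by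
  induction p using MvPolynomial.induction_on with
  | C a => simp
  | add p q hp hq => simp only [map_add, hp, hq, add_smul, Finset.sum_add_distrib]
  | mul_X p k hp =>
    simp only [map_mul, aeval_X, Derivation.leibniz, hp, smul_eq_mul, map_add, add_smul,
      Finset.sum_add_distrib, Finset.smul_sum, pderiv_X, mul_smul]
    congr 1
    rw [Finset.sum_eq_single k]
    · simp
    · intro b _ hb
      simp [hb.symm]
    · simp

open KaehlerDifferential in
lemma isAlgebraic_or_eq_zero_of_fritzJohn {n m : ℕ} {K : Type*} [Field K] [Algebra ℝ K]
    [Algebra.EssFiniteType ℝ K] (f : MvPolynomial (Fin n) ℝ)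
    (g : Fin m → MvPolynomial (Fin n) ℝ) (ξ : Fin n → K) (l : Fin (m + 1) → K)
    (h1 : ∀ i, l 0 * aeval ξ (pderiv i f) = ∑ j, l j.succ * aeval ξ (pderiv i (g j)))
    (h2 : ∀ j, l j.succ * aeval ξ (g j) = 0) : IsAlgebraic ℝ (aeval ξ f) ∨ l 0 = 0 := by
  have h3 : l 0 • D ℝ K (aeval ξ f) = ∑ j, l j.succ • D ℝ K (aeval ξ (g j)) := by
    simp only [kaehlerDifferential_D_aeval, Finset.smul_sum, smul_smul, h1, Finset.sum_smul]
    exact Finset.sum_comm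
  have h4 : ∀ j, l j.succ • D ℝ K (aeval ξ (g j)) = 0 := by
    intro j
    rcases mul_eq_zero.1 (h2 j) with h | h
    · rw [h, zero_smul]
    · rw [h, map_zero, smul_zero]
  rw [Finset.sum_eq_zero fun j _ => h4 j, smul_eq_zero] at h3
  exact h3.symm.imp_left isAlgebraic_of_kaehlerDifferential_D_eq_zero

/-- The polynomial equations defining `VFJ f g`. -/
def fritzJohnPolys {n m : ℕ} (f : MvPolynomial (Fin n) ℝ) (g : Fin m → MvPolynomial (Fin n) ℝ) :
    Set (MvPolynomial (Fin n ⊕ Fin (m + 1)) ℝ) :=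
  Set.range (fun i => X (Sum.inr 0) * rename Sum.inl (pderiv i f) -
      ∑ j : Fin m, X (Sum.inr j.succ) * rename Sum.inl (pderiv i (g j))) ∪
    Set.range (fun j : Fin m => X (Sum.inr j.succ) * rename Sum.inl (g j)) ∪
    {∑ j, X (Sum.inr j) ^ 2 - 1}

lemma finite_fritzJohnPolys {n m : ℕ} (f : MvPolynomial (Fin n) ℝ)
    (g : Fin m → MvPolynomial (Fin n) ℝ) : (fritzJohnPolys f g).Finite :=
  ((Set.finite_range _).union (Set.finite_range _)).union (Set.finite_singleton _)

lemma mem_VFJ_iff {n m : ℕ} {f : MvPolynomial (Fin n) ℝ} {g : Fin m → MvPolynomial (Fin n) ℝ}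
    {p : (Fin n → ℝ) × (Fin (m + 1) → ℝ)} :
    p ∈ VFJ f g ↔ ∀ h ∈ fritzJohnPolys f g, eval (Sum.elim p.1 p.2) h = 0 := by
  simp only [VFJ, fritzJohnPolys, Set.mem_union, Set.mem_range, Set.mem_singleton_iff, or_imp,
    forall_and, forall_exists_index, forall_apply_eq_imp_iff, forall_eq, map_sub, map_mul, map_sum,
    map_pow, map_one, eval_X, eval_rename, Sum.elim_inr, Sum.elim_comp_inl, sub_eq_zero, and_assoc]
  rfl

theorem finite_image_VFJ {n m : ℕ} (f : MvPolynomial (Fin n) ℝ)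
    (g : Fin m → MvPolynomial (Fin n) ℝ)
    (hfin : ((fun x => eval x f) '' Cset g).Finite) :
    ((fun p => eval p.1 f) '' VFJ f g).Finite := by
  classical
  set J := Ideal.span (fritzJohnPolys f g) with hJ
  let F : MvPolynomial (Fin n ⊕ Fin (m + 1)) ℝ := rename Sum.inl f
  have key : ∀ P ∈ J.minimalPrimes, X (Sum.inr 0) ∈ P ∨
      ∃ u : Polynomial ℝ, u ≠ 0 ∧ Polynomial.aeval F u ∈ P := by
    intro P hP
    have hprime : P.IsPrime := hP.1.1
    let K := FractionRing (MvPolynomial (Fin n ⊕ Fin (m + 1)) ℝ ⧸ P)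
    let κ : MvPolynomial (Fin n ⊕ Fin (m + 1)) ℝ →ₐ[ℝ] K :=
      (IsScalarTower.toAlgHom ℝ (MvPolynomial (Fin n ⊕ Fin (m + 1)) ℝ ⧸ P) K).comp
        (Ideal.Quotient.mkₐ ℝ P)
    have hκ : ∀ a, κ a = 0 ↔ a ∈ P := by
      intro a
      rw [← Ideal.Quotient.eq_zero_iff_mem]
      exact map_eq_zero_iff _ (IsFractionRing.injective (_ ⧸ P) K)
    have hJP : ∀ a ∈ fritzJohnPolys f g, κ a = 0 := fun a ha =>
      (hκ a).2 (hP.1.2 (Ideal.subset_span ha))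
    have : Algebra.EssFiniteType (MvPolynomial (Fin n ⊕ Fin (m + 1)) ℝ ⧸ P) K :=
      .of_isLocalization _ (nonZeroDivisors (MvPolynomial (Fin n ⊕ Fin (m + 1)) ℝ ⧸ P))
    have : Algebra.EssFiniteType ℝ K :=
      .comp ℝ (MvPolynomial (Fin n ⊕ Fin (m + 1)) ℝ ⧸ P) K
    have hren : ∀ q : MvPolynomial (Fin n) ℝ, κ (rename Sum.inl q) =
        aeval (fun i => κ (X (Sum.inl i))) q := by
      intro q
      have h := DFunLike.congr_fun (aeval_unique κ) (rename Sum.inl q)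
      rw [aeval_rename] at h
      exact h
    rcases isAlgebraic_or_eq_zero_of_fritzJohn f g (fun i => κ (X (Sum.inl i)))
      (fun j => κ (X (Sum.inr j)))
      (fun i => by
        have := hJP _ (Or.inl (Or.inl ⟨i, rfl⟩))
        simpa only [map_sub, map_mul, map_sum, hren, sub_eq_zero] using this)
      (fun j => by
        have := hJP _ (Or.inl (Or.inr ⟨j, rfl⟩))
        simpa only [map_mul, hren] using this) with h | h
    · obtain ⟨u, hu, hu0⟩ := h
      refine Or.inr ⟨u, hu, ?_⟩
      rw [← hκ, ← Polynomial.aeval_algHom_apply]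
      rwa [← hren] at hu0
    · exact Or.inl ((hκ _).1 h)
  let u : Ideal (MvPolynomial (Fin n ⊕ Fin (m + 1)) ℝ) → Polynomial ℝ := fun P =>
    if h : ∃ u : Polynomial ℝ, u ≠ 0 ∧ Polynomial.aeval F u ∈ P then h.choose else 1
  refine (hfin.union ((Ideal.finite_minimalPrimes_of_isNoetherianRing _ J).biUnion
    fun P _ => ((u P).roots.toFinset.finite_toSet))).subset ?_
  rintro _ ⟨p, hp, rfl⟩
  have hle : J ≤ RingHom.ker (eval (Sum.elim p.1 p.2)) := by
    rw [hJ, Ideal.span_le]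
    exact fun h hh => mem_VFJ_iff.1 hp h hh
  have : (RingHom.ker (eval (Sum.elim p.1 p.2))).IsPrime := RingHom.ker_isPrime _
  obtain ⟨P, hP, hPle⟩ := Ideal.exists_minimalPrimes_le hle
  by_cases h : ∃ u : Polynomial ℝ, u ≠ 0 ∧ Polynomial.aeval F u ∈ P
  · right
    refine Set.mem_biUnion hP ?_
    have hu : u P = h.choose := dif_pos h
    simp only [Finset.mem_coe, Multiset.mem_toFinset]
    rw [hu, Polynomial.mem_roots h.choose_spec.1, Polynomial.IsRoot.def]
    have h1 : eval (Sum.elim p.1 p.2) (Polynomial.aeval F h.choose) = 0 :=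
      hPle h.choose_spec.2
    have h2 : eval (Sum.elim p.1 p.2) (Polynomial.aeval F h.choose) =
        Polynomial.eval (eval (Sum.elim p.1 p.2) F) h.choose := by
      have := Polynomial.aeval_algHom_apply (aeval (R := ℝ) (Sum.elim p.1 p.2)) F h.choose
      simpa [Polynomial.coe_aeval_eq_eval, coe_aeval_eq_eval] using this.symm
    rw [h2] at h1
    simpa [F, eval_rename] using h1
  · left
    have h0 : p.2 0 = 0 := by
      have : eval (Sum.elim p.1 p.2) (X (Sum.inr 0)) = 0 :=
        hPle ((key P hP).resolve_right h)
      simpa using this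
    obtain ⟨hp1, hp2, hp3⟩ := hp
    refine ⟨p.1, ⟨fun j => p.2 j.succ, fun hl => ?_, fun i => ?_, hp2⟩, rfl⟩
    · rw [Fin.sum_univ_succ, h0] at hp3
      have hl' : ∀ j : Fin m, p.2 j.succ = 0 := fun j => congrFun hl j
      simp [hl'] at hp3
    · rw [← hp1 i, h0, zero_mul]

end FritzJohn

section Preordering

variable {σ ι : Type*}

lemma IsSOS.zero : IsSOS (0 : MvPolynomial σ ℝ) := ⟨0, Fin.elim0, by simp⟩

lemma IsSOS.sq (q : MvPolynomial σ ℝ) : IsSOS (q ^ 2) := ⟨1, fun _ => q, by simp⟩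

lemma IsSOS.add {p q : MvPolynomial σ ℝ} (hp : IsSOS p) (hq : IsSOS q) : IsSOS (p + q) := by
  obtain ⟨k, a, rfl⟩ := hp
  obtain ⟨l, b, rfl⟩ := hq
  exact ⟨k + l, Fin.append a b, by simp [Fin.sum_univ_add]⟩

lemma IsSOS.mul_sq {p : MvPolynomial σ ℝ} (hp : IsSOS p) (q : MvPolynomial σ ℝ) :
    IsSOS (p * q ^ 2) := by
  obtain ⟨k, a, rfl⟩ := hp
  exact ⟨k, fun i => a i * q, by simp [Finset.sum_mul, mul_pow]⟩

variable [Fintype ι] [DecidableEq ι] {g : ι → MvPolynomial σ ℝ}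

lemma InPre.of_isSOS_mul_prod {s : MvPolynomial σ ℝ} (hs : IsSOS s) (A : Finset ι) :
    InPre g (s * ∏ j ∈ A, g j) := by
  refine ⟨Pi.single A s, fun B => ?_, ?_⟩
  · by_cases h : B = A
    · subst h
      simpa using hs
    · simpa [h] using IsSOS.zero
  · rw [Finset.sum_eq_single A]
    · simp
    · intro B _ h
      simp [h]
    · simp

lemma InPre.sq (q : MvPolynomial σ ℝ) : InPre g (q ^ 2) := by
  simpa using InPre.of_isSOS_mul_prod (g := g) (IsSOS.sq q) ∅

lemma InPre.zero : InPre g 0 := by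
  simpa using InPre.sq (g := g) 0

lemma InPre.one : InPre g 1 := by
  simpa using InPre.sq (g := g) 1

lemma InPre.generator (j : ι) : InPre g (g j) := by
  simpa using InPre.of_isSOS_mul_prod (g := g) (IsSOS.sq 1) {j}

lemma InPre.add {p q : MvPolynomial σ ℝ} (hp : InPre g p) (hq : InPre g q) : InPre g (p + q) := by
  obtain ⟨s, hs, rfl⟩ := hp
  obtain ⟨t, ht, rfl⟩ := hq
  exact ⟨fun A => s A + t A, fun A => (hs A).add (ht A), by
    simp only [add_mul, Finset.sum_add_distrib]⟩

lemma InPre.sum {κ : Type*} (S : Finset κ) {p : κ → MvPolynomial σ ℝ}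
    (hp : ∀ i ∈ S, InPre g (p i)) : InPre g (∑ i ∈ S, p i) :=
  Finset.sum_induction _ _ (fun _ _ => InPre.add) InPre.zero hp

lemma InPre.mul_sq {p : MvPolynomial σ ℝ} (hp : InPre g p) (q : MvPolynomial σ ℝ) :
    InPre g (p * q ^ 2) := by
  obtain ⟨s, hs, rfl⟩ := hp
  refine ⟨fun A => s A * q ^ 2, fun A => (hs A).mul_sq q, ?_⟩
  rw [Finset.sum_mul]
  exact Finset.sum_congr rfl fun A _ => by ring

lemma InPre.mul_generator {p : MvPolynomial σ ℝ} (hp : InPre g p) (j : ι) :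
    InPre g (p * g j) := by
  obtain ⟨s, hs, rfl⟩ := hp
  rw [Finset.sum_mul]
  refine InPre.sum _ fun A _ => ?_
  by_cases hj : j ∈ A
  · convert InPre.of_isSOS_mul_prod (g := g) ((hs A).mul_sq (g j)) (A.erase j) using 1
    rw [← Finset.mul_prod_erase A g hj]
    ring
  · convert InPre.of_isSOS_mul_prod (g := g) (hs A) (insert j A) using 1
    rw [Finset.prod_insert hj]
    ring

lemma InPre.mul {p q : MvPolynomial σ ℝ} (hp : InPre g p) (hq : InPre g q) :
    InPre g (p * q) := by
  obtain ⟨s, hs, rfl⟩ := hq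
  have hprod : ∀ A : Finset ι, InPre g (p * ∏ j ∈ A, g j) := by
    intro A
    induction A using Finset.induction_on with
    | empty => simpa using hp
    | insert j A hj ih =>
      rw [Finset.prod_insert hj, mul_left_comm, mul_comm]
      exact ih.mul_generator j
  rw [Finset.mul_sum]
  refine InPre.sum _ fun A _ => ?_
  obtain ⟨k, a, ha⟩ := hs A
  rw [ha, mul_left_comm, mul_comm, Finset.mul_sum]
  exact InPre.sum _ fun i _ => (hprod A).mul_sq _

end Preordering

/-- The polynomials agreeing on `V` with an element of the preordering generated by `g`. -/
def preorderingOn {σ ι : Type*} [Fintype ι] [DecidableEq ι] (g : ι → MvPolynomial σ ℝ)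
    (V : Set (σ → ℝ)) : Subsemiring (MvPolynomial σ ℝ) where
  carrier := {q | ∃ p, InPre g p ∧ ∀ v ∈ V, eval v q = eval v p}
  mul_mem' := by
    rintro a b ⟨p, hp, hpa⟩ ⟨q, hq, hqb⟩
    exact ⟨p * q, hp.mul hq, fun v hv => by rw [map_mul, map_mul, hpa v hv, hqb v hv]⟩
  add_mem' := by
    rintro a b ⟨p, hp, hpa⟩ ⟨q, hq, hqb⟩
    exact ⟨p + q, hp.add hq, fun v hv => by rw [map_add, map_add, hpa v hv, hqb v hv]⟩
  one_mem' := ⟨1, InPre.one, fun _ _ => rfl⟩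
  zero_mem' := ⟨0, InPre.zero, fun _ _ => rfl⟩

lemma mem_preorderingOn_of_inPre {σ ι : Type*} [Fintype ι] [DecidableEq ι]
    {g : ι → MvPolynomial σ ℝ} {V : Set (σ → ℝ)} {p : MvPolynomial σ ℝ} (hp : InPre g p) :
    p ∈ preorderingOn g V :=
  ⟨p, hp, fun _ _ => rfl⟩

lemma mem_preorderingOn_of_eval_eq_zero {σ ι : Type*} [Fintype ι] [DecidableEq ι]
    {g : ι → MvPolynomial σ ℝ} {V : Set (σ → ℝ)} {p : MvPolynomial σ ℝ}
    (hp : ∀ v ∈ V, eval v p = 0) : p ∈ preorderingOn g V :=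
  ⟨0, InPre.zero, fun v hv => by rw [hp v hv, map_zero]⟩

/-- If the equations `E` have no common zero at which all the `g j` are non-negative, then `-1`
agrees with an element of the preordering generated by `g` on the common zeros of `E`. -/
theorem exists_inPre_eval_eq_neg_one {σ ι : Type*} [Finite σ] [Fintype ι] [DecidableEq ι]
    (g : ι → MvPolynomial σ ℝ) {E : Set (MvPolynomial σ ℝ)} (hE : E.Finite)
    (h : ∀ v : σ → ℝ, (∀ j, 0 ≤ eval v (g j)) → ∃ p ∈ E, eval v p ≠ 0) :
    ∃ q, InPre g q ∧ ∀ v : σ → ℝ, (∀ p ∈ E, eval v p = 0) → eval v q = -1 := by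
  by_cases hneg : -1 ∈ preorderingOn g {v | ∀ p ∈ E, eval v p = 0}
  · obtain ⟨q, hq, hv⟩ := hneg
    exact ⟨q, hq, fun v h => by simpa using (hv v h).symm⟩
  · exfalso
    obtain ⟨x, hx⟩ := exists_forall_eval_nonneg _
      (fun a => mem_preorderingOn_of_inPre (InPre.sq a)) hneg
      (G := Set.range g ∪ (E ∪ (fun p => -p) '' E))
      ((Set.finite_range g).union (hE.union (hE.image _))) (by
        rintro _ (⟨j, rfl⟩ | h | ⟨p, h, rfl⟩)
        · exact mem_preorderingOn_of_inPre (InPre.generator j)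
        · exact mem_preorderingOn_of_eval_eq_zero fun v hv => hv _ h
        · refine mem_preorderingOn_of_eval_eq_zero fun v hv => ?_
          rw [map_neg, hv p h, neg_zero])
    obtain ⟨p, hp, hp0⟩ := h x fun j => hx _ (Or.inl ⟨j, rfl⟩)
    refine hp0 (le_antisymm ?_ (hx p (Or.inr (Or.inl hp))))
    have := hx (-p) (Or.inr (Or.inr ⟨p, hp, rfl⟩))
    rwa [map_neg, neg_nonneg] at this

lemma exists_inPre_eval_eq {n m : ℕ} (f : MvPolynomial (Fin n) ℝ)
    (g : Fin m → MvPolynomial (Fin n) ℝ) (hf : ∀ x ∈ Sg g, 0 ≤ eval x f) (c : ℝ) :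
    ∃ q : MvPolynomial (Fin n ⊕ Fin (m + 1)) ℝ, InPre (fun j => rename Sum.inl (g j)) q ∧
      ∀ p ∈ VFJ f g, eval p.1 f = c → eval (Sum.elim p.1 p.2) q = c := by
  rcases le_or_gt 0 c with hc | hc
  · refine ⟨C (√c) ^ 2, InPre.sq _, fun p _ _ => ?_⟩
    rw [map_pow, eval_C, Real.sq_sqrt hc]
  · obtain ⟨q, hq, hv⟩ := exists_inPre_eval_eq_neg_one
      (fun j => rename (Sum.inl : Fin n → Fin n ⊕ Fin (m + 1)) (g j))
      ((finite_fritzJohnPolys f g).insert (rename Sum.inl f - C c)) (by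
        intro v hv
        refine ⟨_, Set.mem_insert _ _, ?_⟩
        have := hf (v ∘ Sum.inl) fun j => by simpa [eval_rename] using hv j
        rw [map_sub, eval_C, eval_rename]
        exact ne_of_gt (by linarith))
    refine ⟨q * C (√(-c)) ^ 2, hq.mul_sq _, fun p hp hpc => ?_⟩
    rw [map_mul, map_pow, eval_C, Real.sq_sqrt (by linarith), hv]
    · ring
    · intro h hh
      rcases Set.mem_insert_iff.1 hh with rfl | hh
      · simp [eval_rename, hpc]
      · exact mem_VFJ_iff.1 hp h hh

/-- If `f` is non-negative on `S(g)` and `f(C(g))` is finite, then there is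
`q ∈ P(g)[x, λ̄]` such that `f − q` vanishes on `V(h_FJ)`. -/
theorem rep_preordering_FJ {n m : ℕ} (f : MvPolynomial (Fin n) ℝ)
    (g : Fin m → MvPolynomial (Fin n) ℝ)
    (hf : ∀ x ∈ Sg g, 0 ≤ eval x f)
    (hfin : ((fun x => eval x f) '' Cset g).Finite) :
    ∃ q : MvPolynomial (Fin n ⊕ Fin (m + 1)) ℝ,
      InPre (fun j => rename Sum.inl (g j)) q ∧
      ∀ p ∈ VFJ f g, eval (Sum.elim p.1 p.2) (rename Sum.inl f - q) = 0 := by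
  classical
  have hW := finite_image_VFJ f g hfin
  choose r hr hrc using exists_inPre_eval_eq f g hf
  refine ⟨∑ c ∈ hW.toFinset, r c * Polynomial.aeval (rename Sum.inl f)
    (Lagrange.basis hW.toFinset id c) ^ 2, InPre.sum _ fun c _ => (hr c).mul_sq _, fun p hp => ?_⟩
  have hpW : eval p.1 f ∈ hW.toFinset := hW.mem_toFinset.2 ⟨p, hp, rfl⟩
  have hev : ∀ u : Polynomial ℝ, eval (Sum.elim p.1 p.2)
      (Polynomial.aeval (rename Sum.inl f : MvPolynomial (Fin n ⊕ Fin (m + 1)) ℝ) u) =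
        u.eval (eval p.1 f) := by
    intro u
    have := Polynomial.aeval_algHom_apply (aeval (R := ℝ) (Sum.elim p.1 p.2))
      (rename Sum.inl f) u
    simpa [Polynomial.coe_aeval_eq_eval, coe_aeval_eq_eval, eval_rename] using this.symm
  rw [map_sub, map_sum, sub_eq_zero, eval_rename, Finset.sum_eq_single (eval p.1 f)]
  · rw [map_mul, map_pow, hev, hrc _ p hp rfl]
    have := Lagrange.eval_basis_self (v := (id : ℝ → ℝ)) Function.injective_id.injOn hpW
    rw [id] at this
    rw [this, one_pow, mul_one, Sum.elim_comp_inl]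
  · intro c _ hc
    have := Lagrange.eval_basis_of_ne (v := (id : ℝ → ℝ)) hc hpW
    rw [id] at this
    rw [map_mul, map_pow, hev, this]
    ring
  · exact fun h => absurd hpW h
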